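/- arXiv:2505.16110 — 5 statements merged into one kernel-verified Lean document; each statement's English description precedes it below -/
import Mathlib

section
/- Let n ∈ ℕ, k, ℓ ∈ ℕ with ℓ ≤ k, p ∈ [1,∞), q ∈ (0,∞) satisfy n(1/p − 1/q) ≥ ℓ, and let γ = −ℓq. Then there exists a smooth compactly supported function f : ℝ^n → ℝ such that sup_{λ∈(0,∞)} λ^p ∫_{ℝ^n}[∫_{ℝ^n} 1_{E_{λ,γ/q,k,ℓ}[f]}(x,h) |h|^{γ−n} dh]^{p/q} dx = ∞. -/
open MeasureTheory Filter Set
open scoped ENNReal NNReal BigOperators Topology Classical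

noncomputable section

/-- `ℝ^n`. -/
abbrev En (n : ℕ) := EuclideanSpace ℝ (Fin n)

variable {n : ℕ}

/-- The `k`-th order difference `Δ_h^k f (x) = ∑_{j=0}^k (-1)^{k-j} C(k,j) f (x + j h)`. -/
def kDiff (k : ℕ) (f : En n → ℝ) (h x : En n) : ℝ :=
  ∑ j ∈ Finset.range (k + 1), (-1 : ℝ) ^ (k - j) * (k.choose j : ℝ) * f (x + (j : ℝ) • h)

/-- Membership of `(x,h)` in `E_{λ,b,k,ℓ}[f]`. -/
def memE (k ℓ : ℕ) (lam b : ℝ) (f : En n → ℝ) (x h : En n) : Prop :=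
  h ≠ 0 ∧ lam * ‖h‖ ^ ((ℓ : ℝ) + b) < |kDiff k f h x|

/-- `∫_{ℝ^n} 1_{E_{λ,b,k,ℓ}[f]}(x,h) |h|^{γ-n} dh`. -/
def innerInt (k ℓ : ℕ) (lam b γ : ℝ) (f : En n → ℝ) (x : En n) : ℝ≥0∞ :=
  ∫⁻ h, if memE k ℓ lam b f x h then ENNReal.ofReal (‖h‖ ^ (γ - (n : ℝ))) else 0

/-- `λ (∫_{ℝ^n} (∫_{ℝ^n} 1_E |h|^{γ-n} dh)^{p/q} dx)^{1/p}`. -/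
def bsvy (k ℓ : ℕ) (p q b γ : ℝ) (f : En n → ℝ) (lam : ℝ) : ℝ≥0∞ :=
  ENNReal.ofReal lam * (∫⁻ x, (innerInt k ℓ lam b γ f x) ^ (p / q)) ^ (1 / p)

/-- First-order partial derivative in the `i`-th coordinate direction. -/
def pd (i : Fin n) (ψ : En n → ℝ) : En n → ℝ :=
  fun x => fderiv ℝ ψ x (EuclideanSpace.single i (1 : ℝ))

/-- Higher-order partial derivative `∂^α` associated with a multi-index `α`. -/
def mpd (α : Fin n → ℕ) (φ : En n → ℝ) : En n → ℝ :=
  (List.finRange n).foldr (fun i ψ => (pd i)^[α i] ψ) φ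

/-- `g` is the family of `m`-th order weak partial derivatives of `f`. -/
def HasWeakDerivs (m : ℕ) (f : En n → ℝ) (g : (Fin n → ℕ) → En n → ℝ) : Prop :=
  (∀ α : Fin n → ℕ, (∑ i, α i) = m → LocallyIntegrable (g α) volume) ∧
  ∀ α : Fin n → ℕ, (∑ i, α i) = m →
    ∀ φ : En n → ℝ, ContDiff ℝ (⊤ : ℕ∞) φ → HasCompactSupport φ →
      ∫ x, f x * mpd α φ x = (-1 : ℝ) ^ m * ∫ x, g α x * φ x

/-- `|∇^m f| = (∑_{|α| = m} |∂^α f|^2)^{1/2}`, given the family `g` of weak derivatives. -/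
def gradLen (m : ℕ) (g : (Fin n → ℕ) → En n → ℝ) (x : En n) : ℝ :=
  Real.sqrt (∑' α : Fin n → ℕ, if (∑ i, α i) = m then (g α x) ^ 2 else 0)

/-- The parameter range `Γ_{p,q}`. -/
def Gam (p q : ℝ) : Set ℝ := if p = 1 then Iio (-q) ∪ Ioi 0 else {(0 : ℝ)}ᶜ

/-- `‖ |∇^m f| ‖_{L^p}` as an `ℝ≥0∞`-valued quantity. -/
def gradLp (p : ℝ) (m : ℕ) (g : (Fin n → ℕ) → En n → ℝ) : ℝ≥0∞ :=
  (∫⁻ x, ENNReal.ofReal (gradLen m g x ^ p)) ^ (1 / p)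

end

open MeasureTheory Set
open scoped ENNReal

/-- A power of the norm with exponent at least minus the dimension has infinite integral
near infinity. -/
theorem lintegral_norm_rpow_compl_closedBall_eq_top {E : Type*} [NormedAddCommGroup E]
    [NormedSpace ℝ E] [FiniteDimensional ℝ E] [Nontrivial E] [MeasurableSpace E] [BorelSpace E]
    (μ : Measure E) [μ.IsAddHaarMeasure] {R s : ℝ} (hR : 0 < R)
    (hs : -(Module.finrank ℝ E : ℝ) ≤ s) :
    ∫⁻ x in {x : E | R < ‖x‖}, ENNReal.ofReal (‖x‖ ^ s) ∂μ = ⊤ := by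
  by_contra hne
  have hmeas : MeasurableSet {x : E | R < ‖x‖} := measurableSet_lt measurable_const measurable_norm
  have hint : IntegrableOn (fun x : E => ‖x‖ ^ s) {x : E | R < ‖x‖} μ := by
    refine ⟨(measurable_norm.pow_const s).aestronglyMeasurable, ?_⟩
    rw [hasFiniteIntegral_iff_ofReal (Filter.Eventually.of_forall fun x => by positivity)]
    exact lt_top_iff_ne_top.2 hne
  rw [← integrable_indicator_iff hmeas] at hint
  have hint' : Integrable (fun x : E => (Ioi R).indicator (fun t : ℝ => t ^ s) ‖x‖) μ := hint
  rw [integrable_fun_norm_addHaar] at hint'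
  have hpow : IntegrableOn (fun y : ℝ => y ^ ((Module.finrank ℝ E : ℝ) - 1 + s)) (Ioi R) := by
    refine (hint'.mono_set (Ioi_subset_Ioi hR.le)).congr_fun (fun y hy => ?_) measurableSet_Ioi
    have hy0 : 0 < y := hR.trans hy
    simp only [indicator_of_mem hy, smul_eq_mul]
    rw [Real.rpow_add hy0, ← Nat.cast_pred Module.finrank_pos, Real.rpow_natCast]
  have := (integrableOn_Ioi_rpow_iff hR).1 hpow
  linarith

/-- If `f` vanishes outside the ball of radius `2` and `‖x‖ > 6`, then only the term `j = 1` of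
`Δ_h^k f (x)` survives as soon as `x + h` lies in the unit ball. -/
theorem abs_kDiff_eq_of_eq_zero_of_two_le_norm {n k : ℕ} (hk : 1 ≤ k) {f : En n → ℝ}
    (hf : ∀ y, 2 ≤ ‖y‖ → f y = 0) {x h : En n} (hx : 6 < ‖x‖) (hxh : ‖x + h‖ ≤ 1) :
    |kDiff k f h x| = k * |f (x + h)| := by
  unfold kDiff
  rw [Finset.sum_eq_single 1]
  · simp [abs_mul, abs_pow]
  · intro j _ hj
    rw [hf, mul_zero]
    rcases Nat.lt_or_ge j 1 with h0 | h1
    · obtain rfl : j = 0 := by omega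
      simp only [Nat.cast_zero, zero_smul, add_zero]
      linarith
    · have hj2 : (2 : ℝ) ≤ j := by exact_mod_cast (show 2 ≤ j by omega)
      have hdecomp : ((j : ℝ) - 1) • x = (j : ℝ) • (x + h) - (x + (j : ℝ) • h) := by module
      have hle := norm_sub_le ((j : ℝ) • (x + h)) (x + (j : ℝ) • h)
      rw [← hdecomp, norm_smul, norm_smul, Real.norm_of_nonneg (by linarith),
        Real.norm_of_nonneg (by linarith)] at hle
      nlinarith
  · intro h1
    exact absurd (Finset.mem_range.2 (by omega)) h1

/-- Lower bound for `innerInt` far away from the support of a bump function. -/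
theorem le_innerInt_of_eq_one_of_eq_zero {n k ℓ : ℕ} (hk : 1 ≤ k) {f : En n → ℝ}
    (hf0 : ∀ y, 2 ≤ ‖y‖ → f y = 0) (hf1 : ∀ y, ‖y‖ ≤ 1 → f y = 1) {b γ : ℝ}
    (hb : (ℓ : ℝ) + b = 0) (hγ : γ ≤ n) {x : En n} (hx : 6 < ‖x‖) :
    volume (Metric.closedBall (0 : En n) 1) * ENNReal.ofReal ((2 * ‖x‖) ^ (γ - n)) ≤
      innerInt k ℓ (1 / 2) b γ f x := by
  rw [← Measure.addHaar_closedBall_center volume (-x) 1, mul_comm, ← setLIntegral_const,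
    ← lintegral_indicator measurableSet_closedBall]
  refine lintegral_mono fun h => ?_
  by_cases hh : h ∈ Metric.closedBall (-x) 1
  · have hxh : ‖x + h‖ ≤ 1 := by
      rwa [Metric.mem_closedBall, dist_eq_norm, sub_neg_eq_add, add_comm] at hh
    have hxle : ‖x‖ ≤ ‖x + h‖ + ‖h‖ := by simpa using norm_sub_le (x + h) h
    have hhle : ‖h‖ ≤ ‖x + h‖ + ‖x‖ := by simpa using norm_sub_le (x + h) x
    have hpos : 0 < ‖h‖ := by linarith
    have hmem : memE k ℓ (1 / 2) b f x h := by
      refine ⟨norm_pos_iff.1 hpos, ?_⟩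
      have hk' : (1 : ℝ) ≤ k := by exact_mod_cast hk
      rw [hb, Real.rpow_zero, abs_kDiff_eq_of_eq_zero_of_two_le_norm hk hf0 hx hxh, hf1 _ hxh,
        abs_one]
      linarith
    rw [indicator_of_mem hh, if_pos hmem]
    exact ENNReal.ofReal_le_ofReal
      (Real.rpow_le_rpow_of_nonpos hpos (by linarith) (by linarith))
  · rw [indicator_of_notMem hh]
    exact zero_le

/-- sharpness of the exponent restriction `n(1/p - 1/q) < ℓ`. -/
theorem statement8 (n k ℓ : ℕ) (hn : 0 < n) (hℓ : 0 < ℓ) (hkl : ℓ ≤ k)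
    (p q γ : ℝ) (hp : 1 ≤ p) (hq : 0 < q)
    (hpq : (ℓ : ℝ) ≤ (n : ℝ) * (1 / p - 1 / q)) (hγ : γ = -(ℓ : ℝ) * q) :
    ∃ f : En n → ℝ, ContDiff ℝ (⊤ : ℕ∞) f ∧ HasCompactSupport f ∧
      (⨆ lam ∈ Ioi (0 : ℝ), ENNReal.ofReal lam ^ p *
          ∫⁻ x, (innerInt k ℓ lam (γ / q) γ f x) ^ (p / q)) = ⊤ := by
  have hp0 : 0 < p := by linarith
  have : Nonempty (Fin n) := ⟨⟨0, hn⟩⟩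
  have : Nontrivial (En n) := inferInstance
  let f : ContDiffBump (0 : En n) := ⟨1, 2, one_pos, one_lt_two⟩
  have hf0 : ∀ y, 2 ≤ ‖y‖ → f y = 0 := fun y hy => f.zero_of_le_dist (by simpa using hy)
  have hf1 : ∀ y, ‖y‖ ≤ 1 → f y = 1 := fun y hy => f.one_of_mem_closedBall (by simpa using hy)
  refine ⟨f, f.contDiff, f.hasCompactSupport, ?_⟩
  have hb : (ℓ : ℝ) + γ / q = 0 := by
    rw [hγ]
    field_simp
    ring
  have hγn : γ ≤ n := by
    have : (0 : ℝ) ≤ ℓ * q := by positivity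
    have : (0 : ℝ) ≤ n := by positivity
    linarith
  set s : ℝ := (γ - n) * (p / q) with hs
  have hsn : -(n : ℝ) ≤ s := by
    have hmul := mul_le_mul_of_nonneg_right hpq hp0.le
    have h1 : (n : ℝ) * (1 / p - 1 / q) * p = n - n * (p / q) := by field_simp
    have h2 : s = -(ℓ * p) - n * (p / q) := by
      rw [hs, hγ]
      field_simp
    linarith
  set V := volume (Metric.closedBall (0 : En n) 1) with hV
  have hV0 : V ≠ 0 := (Metric.measure_closedBall_pos volume _ one_pos).ne'
  have hVtop : V ≠ ⊤ := measure_closedBall_lt_top.ne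
  set c : ℝ≥0∞ := V ^ (p / q) * ENNReal.ofReal (2 ^ s) with hc
  have hc0 : c ≠ 0 := mul_ne_zero (ENNReal.rpow_pos (pos_iff_ne_zero.2 hV0) hVtop).ne'
    (ENNReal.ofReal_pos.2 (by positivity)).ne'
  have hctop : c ≠ ⊤ :=
    ENNReal.mul_ne_top (ENNReal.rpow_ne_top_of_nonneg (by positivity) hVtop) ENNReal.ofReal_ne_top
  have hlow : ∀ x ∈ {x : En n | 6 < ‖x‖}, c * ENNReal.ofReal (‖x‖ ^ s) ≤
      innerInt k ℓ (1 / 2) (γ / q) γ f x ^ (p / q) := by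
    intro x hx
    have hpow := ENNReal.rpow_le_rpow
      (le_innerInt_of_eq_one_of_eq_zero (hℓ.trans_le hkl) hf0 hf1 hb hγn hx)
      (show 0 ≤ p / q by positivity)
    have hx0 : 0 < ‖x‖ := lt_trans (by norm_num) hx
    rwa [ENNReal.mul_rpow_of_nonneg _ _ (by positivity),
      ENNReal.ofReal_rpow_of_pos (by positivity), ← Real.rpow_mul (by positivity),
      Real.mul_rpow zero_le_two hx0.le, ENNReal.ofReal_mul (by positivity), ← mul_assoc] at hpow
  have htop : ∫⁻ x, innerInt k ℓ (1 / 2) (γ / q) γ f x ^ (p / q) = ⊤ := by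
    refine top_unique ?_
    calc (⊤ : ℝ≥0∞) = c * ∫⁻ x in {x : En n | 6 < ‖x‖}, ENNReal.ofReal (‖x‖ ^ s) := by
          rw [lintegral_norm_rpow_compl_closedBall_eq_top volume (by norm_num) (by simpa using hsn),
            ENNReal.mul_top hc0]
      _ = ∫⁻ x in {x : En n | 6 < ‖x‖}, c * ENNReal.ofReal (‖x‖ ^ s) :=
          (lintegral_const_mul' _ _ hctop).symm
      _ ≤ ∫⁻ x in {x : En n | 6 < ‖x‖}, innerInt k ℓ (1 / 2) (γ / q) γ f x ^ (p / q) :=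
          setLIntegral_mono' (measurableSet_lt measurable_const measurable_norm) hlow
      _ ≤ _ := setLIntegral_le_lintegral _ _
  refine top_unique (le_iSup₂_of_le (1 / 2 : ℝ) (mem_Ioi.2 (by norm_num)) ?_)
  rw [htop, ENNReal.mul_top]
  exact (ENNReal.rpow_pos (ENNReal.ofReal_pos.2 (by norm_num)) ENNReal.ofReal_ne_top).ne'
end

section
/- Let n, k ∈ ℕ, q, s ∈ (0,∞), and r ∈ [q,∞), and assume s·min{1,q} ≥ k. If f : ℝ^n → ℝ is measurable and (∫_{ℝ^n}[∫_{ℝ^n} |Δ_h^k f(x)|^q |h|^{−n−sq} dh]^{r/q} dx)^{1/r} < ∞, then there exists a polynomial P on ℝ^n of degree at most k−1 such that f = P almost everywhere. -/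
open MeasureTheory Filter Set
open scoped ENNReal NNReal BigOperators Topology Classical

open MeasureTheory Set
open scoped ENNReal

theorem kDiff_eq_fwdDiff_iter {n : ℕ} (k : ℕ) (f : En n → ℝ) (h x : En n) :
    kDiff k f h x = (fwdDiff h)^[k] f x := by
  rw [fwdDiff_iter_eq_sum_shift, kDiff]
  refine Finset.sum_congr rfl fun j _ => ?_
  rw [zsmul_eq_mul, Nat.cast_smul_eq_nsmul]
  push_cast
  ring

/-- A difference with step `N h` is a sum of `N ^ k` shifted differences with step `h`. -/
theorem fwdDiff_iter_nsmul_step {M G : Type*} [AddCommMonoid M] [AddCommGroup G]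
    (N k : ℕ) (h : M) (f : M → G) (x : M) :
    (fwdDiff (N • h))^[k] f x =
      ∑ i : Fin k → Fin N, (fwdDiff h)^[k] f (x + (∑ l, (i l : ℕ)) • h) := by
  induction k generalizing f x with
  | zero => simp
  | succ k ih =>
    have hone : ∀ (g : M → G) (y : M),
        fwdDiff (N • h) g y = ∑ a : Fin N, fwdDiff h g (y + (a : ℕ) • h) := by
      intro g y
      rw [Fin.sum_univ_eq_sum_range (fun a => fwdDiff h g (y + a • h)) N]
      have := Finset.sum_range_sub (fun a : ℕ => g (y + a • h)) N
      simp only [zero_smul, add_zero] at this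
      simp only [fwdDiff, ← this, add_assoc, ← succ_nsmul]
    rw [Function.iterate_succ_apply', hone]
    simp_rw [fwdDiff, ih, ← Finset.sum_sub_distrib]
    rw [← (Fin.consEquiv fun _ : Fin (k + 1) => Fin N).sum_comp, Fintype.sum_prod_type]
    refine Finset.sum_congr rfl fun a _ => Finset.sum_congr rfl fun i _ => ?_
    rw [Function.iterate_succ_apply']
    simp only [fwdDiff, Fin.consEquiv_apply, Fin.sum_univ_succ, Fin.cons_zero, Fin.cons_succ,
      add_nsmul]
    congr 2 <;> abel_nf

/-- Power mean inequality covering all exponents `q > 0`. -/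
theorem rpow_sum_le_card_rpow_mul_sum {ι : Type*} (s : Finset ι) (a : ι → ℝ≥0∞) {q : ℝ}
    (hq : 0 < q) :
    (∑ i ∈ s, a i) ^ q ≤ (s.card : ℝ≥0∞) ^ (max 1 q - 1) * ∑ i ∈ s, a i ^ q := by
  rcases le_total 1 q with h | h
  · rw [max_eq_right h]
    exact ENNReal.rpow_sum_le_const_mul_sum_rpow s a h
  · rw [max_eq_left h, sub_self, ENNReal.rpow_zero, one_mul]
    classical
    induction s using Finset.induction_on with
    | empty => simp [hq]
    | insert i s hi ih =>
      rw [Finset.sum_insert hi, Finset.sum_insert hi]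
      exact (ENNReal.rpow_add_le_add_rpow _ _ hq.le h).trans (add_le_add le_rfl ih)

theorem iteratedDeriv_eq_zero_of_fwdDiff_iter {φ : ℝ → ℝ} {k : ℕ} (hφ : ContDiff ℝ k φ)
    (h0 : ∀ t x, (fwdDiff t)^[k] φ x = 0) (x : ℝ) : iteratedDeriv k φ x = 0 := by
  have h1 : (fun t : ℝ => ∑ j ∈ Finset.range (k + 1),
      ((-1 : ℝ) ^ (k - j) * (k.choose j : ℝ)) * φ (x + (j : ℝ) * t)) = fun _ => 0 := by
    funext t
    rw [← h0 t x, fwdDiff_iter_eq_sum_shift]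
    refine Finset.sum_congr rfl fun j _ => ?_
    simp
  have hshift : ContDiff ℝ k fun z => φ (x + z) := hφ.comp (contDiff_const.add contDiff_id)
  have h2 : iteratedDeriv k (fun t : ℝ => ∑ j ∈ Finset.range (k + 1),
      ((-1 : ℝ) ^ (k - j) * (k.choose j : ℝ)) * φ (x + (j : ℝ) * t)) 0 =
      (∑ j ∈ Finset.range (k + 1), ((-1 : ℝ) ^ (k - j) * (k.choose j : ℝ)) * (j : ℝ) ^ k) *
        iteratedDeriv k φ x := by
    rw [iteratedDeriv_fun_sum, Finset.sum_mul]
    · refine Finset.sum_congr rfl fun j _ => ?_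
      rw [iteratedDeriv_const_mul_field,
        iteratedDeriv_comp_const_mul (f := fun z => φ (x + z)) hshift (j : ℝ),
        iteratedDeriv_comp_const_add]
      simp [mul_assoc]
    · intro j _
      exact (contDiff_const.mul
        (hshift.comp (contDiff_const.mul contDiff_id))).contDiffAt
  have h3 : ∑ j ∈ Finset.range (k + 1), ((-1 : ℝ) ^ (k - j) * (k.choose j : ℝ)) * (j : ℝ) ^ k
      = (k.factorial : ℝ) := by
    have := congrFun (fwdDiff_iter_eq_factorial (R := ℝ) (n := k)) 0
    rw [fwdDiff_iter_eq_sum_shift] at this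
    simpa using this
  rw [h1, h3] at h2
  have h4 : iteratedDeriv k (fun _ : ℝ => (0 : ℝ)) 0 = 0 := by
    simp
  rw [h4] at h2
  have := Nat.factorial_ne_zero k
  rcases mul_eq_zero.1 h2.symm with h | h
  · exact absurd (by exact_mod_cast h) this
  · exact h

/-- The diagonal of a multilinear form is a polynomial in the coordinates. -/
theorem exists_mvPolynomial_of_multilinear {n j : ℕ}
    (T : ContinuousMultilinearMap ℝ (fun _ : Fin j => En n) ℝ) :
    ∃ P : MvPolynomial (Fin n) ℝ, P.totalDegree ≤ j ∧
      ∀ x : En n, T (fun _ => x) = MvPolynomial.eval (fun i => x i) P := by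
  refine ⟨∑ r : Fin j → Fin n, MvPolynomial.C (T fun l => EuclideanSpace.single (r l) 1) *
    ∏ l, MvPolynomial.X (r l), ?_, fun x => ?_⟩
  · refine MvPolynomial.totalDegree_finsetSum_le fun r _ => ?_
    refine (MvPolynomial.totalDegree_mul _ _).trans ?_
    rw [MvPolynomial.totalDegree_C, zero_add]
    refine (MvPolynomial.totalDegree_finsetProd _ _).trans ?_
    simp
  · have hx : x = ∑ i, x i • EuclideanSpace.single i (1 : ℝ) := by
      ext i
      simp [Finset.sum_apply, Pi.single_apply]
    conv_lhs => rw [hx]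
    rw [T.map_sum (fun _ : Fin j => fun i => x i • EuclideanSpace.single i (1 : ℝ))]
    simp only [map_sum, map_mul, map_prod, MvPolynomial.eval_C, MvPolynomial.eval_X]
    refine Finset.sum_congr rfl fun r _ => ?_
    rw [T.map_smul_univ, smul_eq_mul, mul_comm]

theorem exists_mvPolynomial_of_kDiff_eq_zero {n k : ℕ} (hk : 0 < k) {g : En n → ℝ}
    (hg : ContDiff ℝ k g) (h0 : ∀ h x, kDiff k g h x = 0) :
    ∃ P : MvPolynomial (Fin n) ℝ, P.totalDegree ≤ k - 1 ∧
      ∀ x : En n, g x = MvPolynomial.eval (fun i => x i) P := by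
  obtain ⟨m, rfl⟩ : ∃ m, k = m + 1 := ⟨k - 1, by omega⟩
  have key : ∀ x : En n, g x = ∑ j ∈ Finset.range (m + 1),
      (j.factorial : ℝ)⁻¹ * iteratedFDeriv ℝ j g 0 (fun _ => x) := by
    intro x
    set L : ℝ →L[ℝ] En n := ContinuousLinearMap.toSpanSingleton ℝ x with hL
    have hφ : ContDiff ℝ (m + 1 : ℕ) (g ∘ L) := hg.comp L.contDiff
    have hz : ∀ t y, (fwdDiff t)^[m + 1] (g ∘ L) y = 0 := by
      intro t y
      rw [← h0 (L t) (L y), kDiff_eq_fwdDiff_iter, fwdDiff_iter_eq_sum_shift,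
        fwdDiff_iter_eq_sum_shift]
      refine Finset.sum_congr rfl fun j _ => ?_
      rw [Function.comp_apply, map_add, map_nsmul]
    obtain ⟨y, -, hy⟩ := taylor_mean_remainder_lagrange_iteratedDeriv (f := g ∘ L) (x := 1)
      (x₀ := 0) (n := m) zero_ne_one (by exact_mod_cast hφ.contDiffOn)
    rw [iteratedDeriv_eq_zero_of_fwdDiff_iter hφ hz, zero_mul, zero_div, sub_eq_zero,
      taylor_within_apply] at hy
    have h1 : (g ∘ L) 1 = g x := by simp [hL]
    rw [← h1, hy]
    refine Finset.sum_congr rfl fun j hj => ?_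
    have hj' : (j : WithTop ℕ∞) ≤ ((m + 1 : ℕ) : WithTop ℕ∞) := by
      exact_mod_cast (Finset.mem_range.1 hj).le
    rw [iteratedDerivWithin_eq_iteratedDeriv (uniqueDiffOn_uIcc zero_ne_one)
      (hφ.contDiffAt.of_le hj') (by simp), iteratedDeriv_eq_iteratedFDeriv,
      L.iteratedFDeriv_comp_right hg _ hj']
    simp [hL]
  choose Q hQd hQ using fun j => exists_mvPolynomial_of_multilinear (iteratedFDeriv ℝ j g 0)
  refine ⟨∑ j ∈ Finset.range (m + 1), MvPolynomial.C ((j.factorial : ℝ)⁻¹) * Q j, ?_, fun x => ?_⟩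
  · refine MvPolynomial.totalDegree_finsetSum_le fun j hj => ?_
    refine (MvPolynomial.totalDegree_mul _ _).trans ?_
    rw [MvPolynomial.totalDegree_C, zero_add]
    have := hQd j
    have := Finset.mem_range.1 hj
    omega
  · rw [key x]
    simp [hQ]

theorem measurable_kDiff_uncurry {n : ℕ} (k : ℕ) {f : En n → ℝ} (hf : Measurable f) :
    Measurable fun p : En n × En n => kDiff k f p.2 p.1 := by
  unfold kDiff
  refine Finset.measurable_fun_sum _ fun j _ => ?_
  exact (hf.comp (by fun_prop)).const_mul _

theorem exists_reproducing_coeff (k : ℕ) :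
    ∃ d : ℕ → ℝ, ∀ {n : ℕ} (f : En n → ℝ) (h x : En n), kDiff k f h x = 0 →
      f x = ∑ j ∈ Finset.range k, d j * f (x + ((j : ℝ) + 1) • h) := by
  refine ⟨fun j => -((-1) ^ k * ((-1) ^ (k - (j + 1)) * (k.choose (j + 1) : ℝ))),
    fun f h x h0 => ?_⟩
  rw [kDiff, Finset.sum_range_succ'] at h0
  have hsq : ((-1 : ℝ) ^ k) * (-1) ^ k = 1 := by rw [← mul_pow]; simp
  have hx : f x = (-1 : ℝ) ^ k * ((-1 : ℝ) ^ k * f x) := by rw [← mul_assoc, hsq, one_mul]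
  have h1 : (-1 : ℝ) ^ k * f x = -∑ j ∈ Finset.range k,
      (-1 : ℝ) ^ (k - (j + 1)) * (k.choose (j + 1) : ℝ) * f (x + ((j + 1 : ℕ) : ℝ) • h) := by
    rw [eq_neg_iff_add_eq_zero, add_comm, ← h0]
    simp
  rw [hx, h1, ← Finset.sum_neg_distrib, Finset.mul_sum]
  refine Finset.sum_congr rfl fun j _ => ?_
  push_cast
  ring

theorem exists_ae_bound_on_ball {n k : ℕ} {f : En n → ℝ} (hf : Measurable f)
    (h0 : ∀ᵐ x : En n, ∀ᵐ h : En n, kDiff k f h x = 0) (R : ℝ) :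
    ∃ C : ℝ, ∀ᵐ x : En n, ‖x‖ < R → |f x| ≤ C := by
  obtain ⟨d, hd⟩ := exists_reproducing_coeff k
  set A : ℕ → Set (En n) := fun M => Metric.ball 0 (R + k) ∩ {y | (M : ℝ) < |f y|} with hA
  have hAm : ∀ M, MeasurableSet (A M) := fun M =>
    Metric.isOpen_ball.measurableSet.inter (measurableSet_lt measurable_const hf.abs)
  have hlim : Filter.Tendsto (fun M => (k : ℝ≥0∞) * volume (A M)) Filter.atTop (nhds 0) := by
    have h1 : Filter.Tendsto (volume ∘ A) Filter.atTop (nhds (volume (⋂ M, A M))) := by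
      refine tendsto_measure_iInter_atTop (fun M => (hAm M).nullMeasurableSet) ?_ ⟨0, ?_⟩
      · intro M M' hMM y hy
        have hMM' : (M : ℝ) ≤ M' := by exact_mod_cast hMM
        have hy2 : (M' : ℝ) < |f y| := hy.2
        exact ⟨hy.1, hMM'.trans_lt hy2⟩
      · exact ((measure_mono Set.inter_subset_left).trans_lt measure_ball_lt_top).ne
    have h2 : (⋂ M, A M) = ∅ := by
      refine Set.eq_empty_of_forall_notMem fun y hy => ?_
      obtain ⟨M, hM⟩ := exists_nat_ge |f y|
      exact absurd (Set.mem_iInter.1 hy M).2 (not_lt.2 hM)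
    rw [h2, measure_empty] at h1
    simpa using ENNReal.Tendsto.const_mul h1 (Or.inr (ENNReal.natCast_ne_top k))
  obtain ⟨M, hM⟩ := (hlim.eventually (gt_mem_nhds
    (Metric.measure_ball_pos volume (0 : En n) one_pos))).exists
  refine ⟨(∑ j ∈ Finset.range k, |d j|) * M, ?_⟩
  filter_upwards [h0] with x hx hxR
  by_contra hbig
  rw [not_le] at hbig
  refine absurd hM (not_lt.2 ?_)
  have hsub : ∀ᵐ h : En n, h ∈ Metric.ball (0 : En n) 1 →
      h ∈ ⋃ j ∈ Finset.range k, (fun h => ((j : ℝ) + 1) • h) ⁻¹' ((fun y => x + y) ⁻¹' A M) := by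
    filter_upwards [hx] with h hh hh1
    by_contra hno
    simp only [Set.mem_iUnion, Set.mem_preimage, not_exists] at hno
    refine absurd hbig (not_lt.2 ?_)
    rw [hd f h x hh, Finset.sum_mul]
    refine (Finset.abs_sum_le_sum_abs _ _).trans (Finset.sum_le_sum fun j hj => ?_)
    rw [abs_mul]
    refine mul_le_mul_of_nonneg_left ?_ (abs_nonneg _)
    by_contra hlt
    refine hno j hj ⟨?_, not_le.1 hlt⟩
    rw [mem_ball_zero_iff] at hh1 ⊢
    have hjk : (j : ℝ) + 1 ≤ k := by exact_mod_cast Finset.mem_range.1 hj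
    have hj0 : (0 : ℝ) < (j : ℝ) + 1 := by positivity
    calc ‖x + ((j : ℝ) + 1) • h‖ ≤ ‖x‖ + ((j : ℝ) + 1) * ‖h‖ := by
          refine (norm_add_le _ _).trans ?_
          rw [norm_smul, Real.norm_of_nonneg hj0.le]
      _ < R + k := by nlinarith [norm_nonneg h]
  calc volume (Metric.ball (0 : En n) 1)
      ≤ volume (⋃ j ∈ Finset.range k,
          (fun h : En n => ((j : ℝ) + 1) • h) ⁻¹' ((fun y => x + y) ⁻¹' A M)) :=
        measure_mono_ae hsub
    _ ≤ ∑ j ∈ Finset.range k,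
          volume ((fun h : En n => ((j : ℝ) + 1) • h) ⁻¹' ((fun y => x + y) ⁻¹' A M)) :=
        measure_biUnion_finset_le _ _
    _ ≤ ∑ _j ∈ Finset.range k, volume (A M) := by
        refine Finset.sum_le_sum fun j _ => ?_
        have hj0 : (1 : ℝ) ≤ (j : ℝ) + 1 := by simp
        rw [Measure.addHaar_preimage_smul _ (by positivity), measure_preimage_add]
        refine mul_le_of_le_one_left' ?_
        rw [ENNReal.ofReal_le_one, abs_of_nonneg (by positivity)]
        exact inv_le_one_of_one_le₀ (one_le_pow₀ hj0)
    _ = k * volume (A M) := by simp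

theorem locallyIntegrable_of_ae_bound_on_balls {n : ℕ} {f : En n → ℝ} (hf : Measurable f)
    (hb : ∀ R : ℝ, ∃ C : ℝ, ∀ᵐ x : En n, ‖x‖ < R → |f x| ≤ C) :
    LocallyIntegrable f volume := by
  intro x
  obtain ⟨C, hC⟩ := hb (‖x‖ + 1)
  refine ⟨Metric.ball 0 (‖x‖ + 1), Metric.isOpen_ball.mem_nhds (by simp), ?_⟩
  refine Measure.integrableOn_of_bounded (M := C) measure_ball_lt_top.ne
    hf.aestronglyMeasurable ?_
  rw [ae_restrict_iff' Metric.isOpen_ball.measurableSet]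
  filter_upwards [hC] with y hy hyb
  exact hy (mem_ball_zero_iff.1 hyb)

theorem exists_contDiff_ae_eq_of_kDiff {n k : ℕ} {f : En n → ℝ} (hf : LocallyIntegrable f volume)
    (h0 : ∀ᵐ x : En n, ∀ᵐ h : En n, kDiff k f h x = 0) :
    ∃ g : En n → ℝ, ContDiff ℝ k g ∧ f =ᵐ[volume] g := by
  obtain ⟨d, hd⟩ := exists_reproducing_coeff k
  let φ : ContDiffBump (0 : En n) := ⟨1, 2, one_pos, one_lt_two⟩
  set w : En n → ℝ := φ.normed volume with hw
  have hwc : HasCompactSupport w := φ.hasCompactSupport_normed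
  have hwd : ContDiff ℝ k w := φ.contDiff_normed (n := (k : ℕ∞))
  set L := ContinuousLinearMap.mul ℝ ℝ
  have hc : ∀ j : ℕ, ((j : ℝ) + 1) ≠ 0 := fun j => by positivity
  set ψ : ℕ → En n → ℝ := fun j z => w ((-((j : ℝ) + 1)⁻¹) • z) with hψ
  have hψc : ∀ j, HasCompactSupport (ψ j) := fun j =>
    hwc.comp_smul (neg_ne_zero.2 (inv_ne_zero (hc j)))
  have hψd : ∀ j, ContDiff ℝ k (ψ j) := fun j => hwd.comp (contDiff_const_smul _)
  have hker : ∀ (j : ℕ) (x h : En n), f (x + ((j : ℝ) + 1) • h) * w h =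
      (fun t => L (f t) (ψ j (x - t))) (x + ((j : ℝ) + 1) • h) := by
    intro j x h
    have hs : (-((j : ℝ) + 1)⁻¹) • (x - (x + ((j : ℝ) + 1) • h)) = h := by
      rw [sub_add_cancel_left, neg_smul, smul_neg, neg_neg, smul_smul, inv_mul_cancel₀ (hc j),
        one_smul]
    simp only [hψ, hs, L, ContinuousLinearMap.mul_apply']
  have hintg : ∀ (j : ℕ) (x : En n),
      Integrable fun h : En n => f (x + ((j : ℝ) + 1) • h) * w h := by
    intro j x
    simp only [hker]
    have hE : Integrable (fun t => L (f t) (ψ j (x - t))) :=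
      (hψc j).convolutionExists_right L hf (hψd j).continuous x
    exact (hE.comp_add_left x).comp_smul (hc j)
  refine ⟨fun x => ∑ j ∈ Finset.range k, d j *
    (|(((j : ℝ) + 1) ^ Module.finrank ℝ (En n))⁻¹| * convolution f (ψ j) L volume x), ?_, ?_⟩
  · refine ContDiff.sum fun j _ => contDiff_const.mul (contDiff_const.mul ?_)
    exact (hψc j).contDiff_convolution_right L (n := (k : ℕ∞)) hf (hψd j)
  · filter_upwards [h0] with x hx
    calc f x = ∫ h : En n, f x * w h := by
          rw [integral_const_mul, φ.integral_normed, mul_one]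
      _ = ∫ h : En n, ∑ j ∈ Finset.range k, d j * (f (x + ((j : ℝ) + 1) • h) * w h) := by
          refine integral_congr_ae ?_
          filter_upwards [hx] with h hh
          rw [hd f h x hh, Finset.sum_mul]
          exact Finset.sum_congr rfl fun j _ => mul_assoc _ _ _
      _ = ∑ j ∈ Finset.range k, d j * ∫ h : En n, f (x + ((j : ℝ) + 1) • h) * w h := by
          rw [integral_finsetSum _ fun j _ => (hintg j x).const_mul _]
          exact Finset.sum_congr rfl fun j _ => integral_const_mul _ _
      _ = _ := by
          refine Finset.sum_congr rfl fun j _ => ?_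
          congr 1
          simp only [hker]
          rw [Measure.integral_comp_smul volume
            (fun y => (fun t => L (f t) (ψ j (x - t))) (x + y)), smul_eq_mul,
            integral_add_left_eq_self (fun t => L (f t) (ψ j (x - t))) x, convolution_def]

theorem kDiff_eq_zero_of_ae {n k : ℕ} {f g : En n → ℝ} (hg : Continuous g)
    (hfg : f =ᵐ[volume] g) (h0 : ∀ᵐ h : En n, ∀ᵐ x : En n, kDiff k f h x = 0) (h x : En n) :
    kDiff k g h x = 0 := by
  have hcx : ∀ h, Continuous fun x => kDiff k g h x := fun h => by
    unfold kDiff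
    fun_prop
  have hch : ∀ x, Continuous fun h => kDiff k g h x := fun x => by
    unfold kDiff
    fun_prop
  have h1 : ∀ᵐ h : En n, ∀ x, kDiff k g h x = 0 := by
    filter_upwards [h0] with h hh
    have hshift : ∀ᵐ x : En n, ∀ j : ℕ, f (x + (j : ℝ) • h) = g (x + (j : ℝ) • h) :=
      ae_all_iff.2 fun j =>
        (measurePreserving_add_right volume ((j : ℝ) • h)).quasiMeasurePreserving.ae hfg
    have hz : (fun x => kDiff k g h x) =ᵐ[volume] fun _ => 0 := by
      filter_upwards [hh, hshift] with x hx hs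
      rw [← hx]
      simp only [kDiff, hs]
    exact congrFun (((hcx h).ae_eq_iff_eq volume continuous_const).1 hz)
  have hz : (fun h => kDiff k g h x) =ᵐ[volume] fun _ => 0 := by
    filter_upwards [h1] with h hh using hh x
  exact congrFun (((hch x).ae_eq_iff_eq volume continuous_const).1 hz) h

/-- A measurable function whose `k`-th differences vanish almost everywhere agrees almost
everywhere with a polynomial of degree less than `k`. -/
theorem exists_mvPolynomial_of_ae_kDiff_eq_zero {n k : ℕ} (hk : 0 < k) {f : En n → ℝ}
    (hf : Measurable f) (h0 : ∀ᵐ h : En n, ∀ᵐ x : En n, kDiff k f h x = 0) :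
    ∃ P : MvPolynomial (Fin n) ℝ, P.totalDegree ≤ k - 1 ∧
      ∀ᵐ x : En n, f x = MvPolynomial.eval (fun i => x i) P := by
  have h0' : ∀ᵐ x : En n, ∀ᵐ h : En n, kDiff k f h x = 0 :=
    (Measure.ae_ae_comm (p := fun x h => kDiff k f h x = 0)
      (measurable_kDiff_uncurry k hf (measurableSet_singleton 0))).2 h0
  obtain ⟨g, hg, hfg⟩ := exists_contDiff_ae_eq_of_kDiff
    (locallyIntegrable_of_ae_bound_on_balls hf (exists_ae_bound_on_ball hf h0')) h0'
  obtain ⟨P, hP, hgP⟩ := exists_mvPolynomial_of_kDiff_eq_zero hk hg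
    (kDiff_eq_zero_of_ae hg.continuous hfg h0)
  refine ⟨P, hP, ?_⟩
  filter_upwards [hfg] with x hx
  rw [hx, hgP]

theorem setLIntegral_ball_add_right_le {n : ℕ} (G : En n → ℝ≥0∞) {R R' : ℝ} {v : En n}
    (hv : R + ‖v‖ ≤ R') :
    ∫⁻ x in Metric.ball 0 R, G (x + v) ≤ ∫⁻ x in Metric.ball 0 R', G x := by
  rw [← lintegral_indicator Metric.isOpen_ball.measurableSet,
    ← lintegral_indicator Metric.isOpen_ball.measurableSet,
    ← lintegral_add_right_eq_self ((Metric.ball (0 : En n) R').indicator G) v]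
  refine lintegral_mono fun x => ?_
  by_cases hx : x ∈ Metric.ball (0 : En n) R
  · have hxv : x + v ∈ Metric.ball (0 : En n) R' := by
      rw [mem_ball_zero_iff] at hx ⊢
      linarith [norm_add_le x v]
    rw [Set.indicator_of_mem hx, Set.indicator_of_mem hxv]
  · rw [Set.indicator_of_notMem hx]
    exact zero_le

theorem lintegral_eq_mul_lintegral_comp_smul {n : ℕ} (H : En n → ℝ≥0∞) (hH : Measurable H)
    {c : ℝ} (hc : 0 < c) :
    ∫⁻ h, H h = ENNReal.ofReal (c ^ n) * ∫⁻ u, H (c • u) := by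
  rw [← lintegral_map hH (measurable_const_smul c), Measure.map_addHaar_smul _ hc.ne',
    lintegral_smul_measure, smul_eq_mul, ← mul_assoc, finrank_euclideanSpace_fin,
    ← ENNReal.ofReal_mul (by positivity), abs_of_pos (by positivity),
    mul_inv_cancel₀ (by positivity), ENNReal.ofReal_one, one_mul]

theorem measurable_enorm_kDiff_rpow {n : ℕ} (k : ℕ) {f : En n → ℝ} (hf : Measurable f)
    (q : ℝ) (h : En n) : Measurable fun x => ‖kDiff k f h x‖ₑ ^ q :=
  ((measurable_kDiff_uncurry k hf).comp (measurable_id.prodMk measurable_const)).enorm.pow_const q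

theorem setLIntegral_kDiff_smul_le {n k N : ℕ} {f : En n → ℝ} (hf : Measurable f)
    {q : ℝ} (hq : 0 < q) {R R' : ℝ} {u : En n} (hR : R + k * N * ‖u‖ ≤ R') :
    ∫⁻ x in Metric.ball 0 R, ‖kDiff k f ((N : ℝ) • u) x‖ₑ ^ q ≤
      ENNReal.ofReal ((N : ℝ) ^ (k * max 1 q)) *
        ∫⁻ x in Metric.ball 0 R', ‖kDiff k f u x‖ₑ ^ q := by
  have hcard : (Finset.univ : Finset (Fin k → Fin N)).card = N ^ k := by simp
  have hpt : ∀ x, ‖kDiff k f ((N : ℝ) • u) x‖ₑ ^ q ≤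
      ((N ^ k : ℕ) : ℝ≥0∞) ^ (max 1 q - 1) *
        ∑ i : Fin k → Fin N, ‖kDiff k f u (x + (∑ l, (i l : ℕ)) • u)‖ₑ ^ q := by
    intro x
    rw [kDiff_eq_fwdDiff_iter, Nat.cast_smul_eq_nsmul, fwdDiff_iter_nsmul_step]
    simp only [kDiff_eq_fwdDiff_iter]
    refine (ENNReal.rpow_le_rpow (enorm_sum_le _ _) hq.le).trans ?_
    rw [← hcard]
    exact rpow_sum_le_card_rpow_mul_sum _ _ hq
  have hshift : ∀ i : Fin k → Fin N,
      ∫⁻ x in Metric.ball 0 R, ‖kDiff k f u (x + (∑ l, (i l : ℕ)) • u)‖ₑ ^ q ≤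
        ∫⁻ x in Metric.ball 0 R', ‖kDiff k f u x‖ₑ ^ q := by
    intro i
    refine setLIntegral_ball_add_right_le (fun x => ‖kDiff k f u x‖ₑ ^ q) (le_trans ?_ hR)
    have hsum : ∑ l, (i l : ℕ) ≤ k * N := by
      refine (Finset.sum_le_card_nsmul _ _ N fun l _ => (i l).2.le).trans ?_
      simp
    have hsum' : ((∑ l, (i l : ℕ) : ℕ) : ℝ) ≤ k * N := by exact_mod_cast hsum
    rw [← Nat.cast_smul_eq_nsmul ℝ, norm_smul, Real.norm_of_nonneg (Nat.cast_nonneg _)]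
    gcongr
  have hconst : ((N ^ k : ℕ) : ℝ≥0∞) ^ (max 1 q - 1) * ((N ^ k : ℕ) : ℝ≥0∞) =
      ENNReal.ofReal ((N : ℝ) ^ (k * max 1 q)) := by
    have hm : (0 : ℝ) ≤ max 1 q - 1 := sub_nonneg.2 (le_max_left _ _)
    nth_rw 2 [← ENNReal.rpow_one ((N ^ k : ℕ) : ℝ≥0∞)]
    rw [← ENNReal.rpow_add_of_nonneg _ _ hm zero_le_one, sub_add_cancel,
      ← ENNReal.ofReal_natCast, ENNReal.ofReal_rpow_of_nonneg (Nat.cast_nonneg _) (by positivity),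
      Real.rpow_mul (Nat.cast_nonneg _), Real.rpow_natCast, Nat.cast_pow]
  calc ∫⁻ x in Metric.ball 0 R, ‖kDiff k f ((N : ℝ) • u) x‖ₑ ^ q
      ≤ ∫⁻ x in Metric.ball 0 R, ((N ^ k : ℕ) : ℝ≥0∞) ^ (max 1 q - 1) *
        ∑ i : Fin k → Fin N, ‖kDiff k f u (x + (∑ l, (i l : ℕ)) • u)‖ₑ ^ q :=
        lintegral_mono hpt
    _ = ((N ^ k : ℕ) : ℝ≥0∞) ^ (max 1 q - 1) * ∑ i : Fin k → Fin N,
        ∫⁻ x in Metric.ball 0 R, ‖kDiff k f u (x + (∑ l, (i l : ℕ)) • u)‖ₑ ^ q := by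
        have hm : ∀ i : Fin k → Fin N,
            Measurable fun x => ‖kDiff k f u (x + (∑ l, (i l : ℕ)) • u)‖ₑ ^ q :=
          fun i => (measurable_enorm_kDiff_rpow k hf q u).comp (measurable_add_const _)
        rw [lintegral_const_mul _ (Finset.measurable_fun_sum _ fun i _ => hm i),
          lintegral_finsetSum _ fun i _ => hm i]
    _ ≤ ((N ^ k : ℕ) : ℝ≥0∞) ^ (max 1 q - 1) * ∑ _i : Fin k → Fin N,
        ∫⁻ x in Metric.ball 0 R', ‖kDiff k f u x‖ₑ ^ q := by
        exact mul_le_mul' le_rfl (Finset.sum_le_sum fun i _ => hshift i)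
    _ = _ := by
        rw [Finset.sum_const, hcard, nsmul_eq_mul, ← mul_assoc, hconst]

theorem measurable_setLIntegral_kDiff {n : ℕ} (k : ℕ) {f : En n → ℝ} (hf : Measurable f)
    (q R : ℝ) :
    Measurable fun h : En n => ∫⁻ x in Metric.ball 0 R, ‖kDiff k f h x‖ₑ ^ q :=
  Measurable.lintegral_prod_right' (ν := volume.restrict (Metric.ball (0 : En n) R))
    (f := fun p : En n × En n => ‖kDiff k f p.1 p.2‖ₑ ^ q)
    (((measurable_kDiff_uncurry k hf).comp measurable_swap).enorm.pow_const q)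

theorem measurable_ofReal_norm_rpow {n : ℕ} (a : ℝ) :
    Measurable fun h : En n => ENNReal.ofReal (‖h‖ ^ a) :=
  (measurable_norm.pow_const a).ennreal_ofReal

theorem measurable_setLIntegral_kDiff_mul_weight {n : ℕ} (k : ℕ) {f : En n → ℝ} (hf : Measurable f)
    (q R a : ℝ) :
    Measurable fun h : En n => (∫⁻ x in Metric.ball 0 R, ‖kDiff k f h x‖ₑ ^ q) *
      ENNReal.ofReal (‖h‖ ^ a) :=
  (measurable_setLIntegral_kDiff k hf q R).mul (measurable_ofReal_norm_rpow a)

/-- Rescaling the step variable by `N` moves the weighted energy of the differences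
to steps of size `ρ / N`. -/
theorem setLIntegral_weighted_kDiff_le {n k N : ℕ} (hN : 1 ≤ N) {f : En n → ℝ}
    (hf : Measurable f) {q σ : ℝ} (hq : 0 < q) (hσ : k * max 1 q ≤ σ) (R : ℝ) {ρ : ℝ} :
    ∫⁻ h in Metric.ball 0 ρ, (∫⁻ x in Metric.ball 0 R, ‖kDiff k f h x‖ₑ ^ q) *
        ENNReal.ofReal (‖h‖ ^ (-(n : ℝ) - σ)) ≤
      ∫⁻ u in Metric.ball 0 (ρ / N),
        (∫⁻ x in Metric.ball 0 (R + k * ρ), ‖kDiff k f u x‖ₑ ^ q) *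
        ENNReal.ofReal (‖u‖ ^ (-(n : ℝ) - σ)) := by
  have hN0 : (0 : ℝ) < N := by exact_mod_cast hN
  have hN1 : (1 : ℝ) ≤ N := by exact_mod_cast hN
  have hH : Measurable ((Metric.ball (0 : En n) ρ).indicator fun h =>
      (∫⁻ x in Metric.ball 0 R, ‖kDiff k f h x‖ₑ ^ q) * ENNReal.ofReal (‖h‖ ^ (-(n : ℝ) - σ))) :=
    (measurable_setLIntegral_kDiff_mul_weight k hf q R _).indicator Metric.isOpen_ball.measurableSet
  have hHN : Measurable fun u : En n => (Metric.ball (0 : En n) ρ).indicator (fun h =>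
      (∫⁻ x in Metric.ball 0 R, ‖kDiff k f h x‖ₑ ^ q) *
        ENNReal.ofReal (‖h‖ ^ (-(n : ℝ) - σ))) ((N : ℝ) • u) :=
    hH.comp (measurable_const_smul _)
  rw [← lintegral_indicator Metric.isOpen_ball.measurableSet,
    ← lintegral_indicator Metric.isOpen_ball.measurableSet,
    lintegral_eq_mul_lintegral_comp_smul _ hH hN0, ← lintegral_const_mul _ hHN]
  refine lintegral_mono fun u => ?_
  by_cases hu : ‖u‖ < ρ / N
  · have hNu : N * ‖u‖ < ρ := by rwa [lt_div_iff₀' hN0] at hu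
    have hnorm : ‖(N : ℝ) • u‖ = N * ‖u‖ := by rw [norm_smul, Real.norm_of_nonneg hN0.le]
    dsimp only
    rw [Set.indicator_of_mem (by rwa [mem_ball_zero_iff, hnorm]),
      Set.indicator_of_mem (by rwa [mem_ball_zero_iff]), hnorm,
      Real.mul_rpow hN0.le (norm_nonneg u), ENNReal.ofReal_mul (by positivity)]
    have hle := setLIntegral_kDiff_smul_le (k := k) (N := N) hf hq (R := R) (R' := R + k * ρ)
      (u := u) (by rw [mul_assoc]; gcongr)
    have hc : ENNReal.ofReal ((N : ℝ) ^ n) * ENNReal.ofReal ((N : ℝ) ^ (k * max 1 q)) *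
        ENNReal.ofReal ((N : ℝ) ^ (-(n : ℝ) - σ)) ≤ 1 := by
      rw [← ENNReal.ofReal_mul (by positivity), ← ENNReal.ofReal_mul (by positivity),
        ENNReal.ofReal_le_one, ← Real.rpow_natCast, ← Real.rpow_add hN0, ← Real.rpow_add hN0]
      exact Real.rpow_le_one_of_one_le_of_nonpos hN1 (by linarith)
    set I := ∫⁻ x in Metric.ball 0 (R + k * ρ), ‖kDiff k f u x‖ₑ ^ q
    set W := ENNReal.ofReal (‖u‖ ^ (-(n : ℝ) - σ))
    calc _ ≤ ENNReal.ofReal ((N : ℝ) ^ n) *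
          (ENNReal.ofReal ((N : ℝ) ^ (k * max 1 q)) * I *
            (ENNReal.ofReal ((N : ℝ) ^ (-(n : ℝ) - σ)) * W)) := by gcongr
      _ = (ENNReal.ofReal ((N : ℝ) ^ n) * ENNReal.ofReal ((N : ℝ) ^ (k * max 1 q)) *
        ENNReal.ofReal ((N : ℝ) ^ (-(n : ℝ) - σ))) * (I * W) := by ring
      _ ≤ I * W := mul_le_of_le_one_left' hc
  · dsimp only
    rw [Set.indicator_of_notMem, mul_zero]
    · exact zero_le
    · rw [mem_ball_zero_iff, norm_smul, Real.norm_of_nonneg hN0.le, ← lt_div_iff₀' hN0]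
      exact hu

theorem setLIntegral_weighted_kDiff_eq_zero {n k : ℕ} (hn : 0 < n) {f : En n → ℝ}
    (hf : Measurable f) {q σ : ℝ} (hq : 0 < q) (hσ : k * max 1 q ≤ σ)
    (hfin : ∀ R : ℝ, ∫⁻ h, (∫⁻ x in Metric.ball 0 R, ‖kDiff k f h x‖ₑ ^ q) *
        ENNReal.ofReal (‖h‖ ^ (-(n : ℝ) - σ)) ≠ ⊤) (R ρ : ℝ) :
    ∫⁻ h in Metric.ball 0 ρ, (∫⁻ x in Metric.ball 0 R, ‖kDiff k f h x‖ₑ ^ q) *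
        ENNReal.ofReal (‖h‖ ^ (-(n : ℝ) - σ)) = 0 := by
  have : Nonempty (Fin n) := ⟨⟨0, hn⟩⟩
  have hball : Filter.Tendsto (volume ∘ fun N : ℕ => Metric.ball (0 : En n) (ρ / N))
      Filter.atTop (nhds 0) := by
    have hr : Filter.Tendsto (fun N : ℕ => ENNReal.ofReal ((ρ / N) ^ n) *
        volume (Metric.ball (0 : En n) 1)) Filter.atTop (nhds 0) := by
      have h1 : Filter.Tendsto (fun N : ℕ => ENNReal.ofReal ((ρ / N) ^ n))
          Filter.atTop (nhds 0) := by
        have := ENNReal.tendsto_ofReal ((tendsto_const_div_atTop_nhds_zero_nat ρ).pow n)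
        simpa [hn.ne'] using this
      simpa using ENNReal.Tendsto.mul_const h1 (Or.inr measure_ball_lt_top.ne)
    refine tendsto_of_tendsto_of_tendsto_of_le_of_le tendsto_const_nhds hr
      (fun _ => zero_le) fun N => ?_
    rcases le_or_gt 0 (ρ / N) with h | h
    · simp only [Function.comp_apply]
      rw [Measure.addHaar_ball _ _ h, finrank_euclideanSpace_fin]
    · simp [Metric.ball_eq_empty.2 h.le]
  have hlim := tendsto_setLIntegral_zero (hfin (R + k * ρ)) hball
  refine le_antisymm (ge_of_tendsto hlim ?_) zero_le
  filter_upwards [Filter.eventually_ge_atTop 1] with N hN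
  exact setLIntegral_weighted_kDiff_le hN hf hq hσ R

theorem ae_kDiff_eq_zero_of_lintegral_ne_top {n k : ℕ} (hn : 0 < n) {f : En n → ℝ}
    (hf : Measurable f) {q σ : ℝ} (hq : 0 < q) (hσ : k * max 1 q ≤ σ)
    (hfin : ∀ R : ℝ, ∫⁻ h, (∫⁻ x in Metric.ball 0 R, ‖kDiff k f h x‖ₑ ^ q) *
        ENNReal.ofReal (‖h‖ ^ (-(n : ℝ) - σ)) ≠ ⊤) :
    ∀ᵐ h : En n, ∀ᵐ x : En n, kDiff k f h x = 0 := by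
  have : Nonempty (Fin n) := ⟨⟨0, hn⟩⟩
  have h1 : ∀ᵐ h : En n, ∀ m : ℕ, h ∈ Metric.ball (0 : En n) m →
      (∫⁻ x in Metric.ball 0 m, ‖kDiff k f h x‖ₑ ^ q) *
        ENNReal.ofReal (‖h‖ ^ (-(n : ℝ) - σ)) = 0 := by
    refine ae_all_iff.2 fun m => ?_
    have h0 := setLIntegral_weighted_kDiff_eq_zero hn hf hq hσ hfin m m
    rw [lintegral_eq_zero_iff (measurable_setLIntegral_kDiff_mul_weight k hf q m _)] at h0
    exact (ae_restrict_iff' Metric.isOpen_ball.measurableSet).1 h0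
  filter_upwards [h1, Measure.ae_ne volume (0 : En n)] with h hh hne
  have h2 : ∀ᵐ x : En n, ∀ m : ℕ, h ∈ Metric.ball (0 : En n) m →
      x ∈ Metric.ball (0 : En n) m → kDiff k f h x = 0 := by
    refine ae_all_iff.2 fun m => ?_
    by_cases hm : h ∈ Metric.ball (0 : En n) m
    · have hI : ∫⁻ x in Metric.ball 0 (m : ℝ), ‖kDiff k f h x‖ₑ ^ q = 0 := by
        refine (mul_eq_zero.1 (hh m hm)).resolve_right ?_
        rw [ENNReal.ofReal_eq_zero, not_le]
        exact Real.rpow_pos_of_pos (norm_pos_iff.2 hne) _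
      rw [lintegral_eq_zero_iff (measurable_enorm_kDiff_rpow k hf q h)] at hI
      filter_upwards [(ae_restrict_iff' Metric.isOpen_ball.measurableSet).1 hI] with x hx _ hxm
      have := hx hxm
      simpa [ENNReal.rpow_eq_zero_iff, hq, hq.not_gt] using this
    · exact Filter.Eventually.of_forall fun x h' => absurd h' hm
  filter_upwards [h2] with x hx
  obtain ⟨m, hm⟩ := exists_nat_gt (max ‖h‖ ‖x‖)
  exact hx m (mem_ball_zero_iff.2 ((le_max_left _ _).trans_lt hm))
    (mem_ball_zero_iff.2 ((le_max_right _ _).trans_lt hm))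

theorem lintegral_weighted_kDiff_ne_top {n k : ℕ} {f : En n → ℝ} (hf : Measurable f)
    {q σ r : ℝ} (hq : 0 < q) (hr : q ≤ r)
    (hfin : (∫⁻ x, (∫⁻ h, ENNReal.ofReal
        (|kDiff k f h x| ^ q * ‖h‖ ^ (-(n : ℝ) - σ))) ^ (r / q)) ^ (1 / r) < ⊤) (R : ℝ) :
    ∫⁻ h, (∫⁻ x in Metric.ball 0 R, ‖kDiff k f h x‖ₑ ^ q) *
        ENNReal.ofReal (‖h‖ ^ (-(n : ℝ) - σ)) ≠ ⊤ := by
  have hr0 : 0 < r := hq.trans_le hr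
  have hintegrand : ∀ x h : En n, ENNReal.ofReal (|kDiff k f h x| ^ q * ‖h‖ ^ (-(n : ℝ) - σ)) =
      ‖kDiff k f h x‖ₑ ^ q * ENNReal.ofReal (‖h‖ ^ (-(n : ℝ) - σ)) := by
    intro x h
    rw [ENNReal.ofReal_mul (by positivity), Real.enorm_eq_ofReal_abs,
      ENNReal.ofReal_rpow_of_nonneg (abs_nonneg _) hq.le]
  simp only [hintegrand] at hfin
  have hmeas : Measurable fun p : En n × En n =>
      ‖kDiff k f p.1 p.2‖ₑ ^ q * ENNReal.ofReal (‖p.1‖ ^ (-(n : ℝ) - σ)) :=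
    (((measurable_kDiff_uncurry k hf).comp measurable_swap).enorm.pow_const q).mul
      ((measurable_ofReal_norm_rpow _).comp measurable_fst)
  have hpow : ∫⁻ x, (∫⁻ h, ‖kDiff k f h x‖ₑ ^ q *
      ENNReal.ofReal (‖h‖ ^ (-(n : ℝ) - σ))) ^ (r / q) ≠ ⊤ := by
    intro htop
    rw [htop, ENNReal.top_rpow_of_pos (by positivity)] at hfin
    exact lt_irrefl _ hfin
  have hswap : ∫⁻ h, (∫⁻ x in Metric.ball 0 R, ‖kDiff k f h x‖ₑ ^ q) *
        ENNReal.ofReal (‖h‖ ^ (-(n : ℝ) - σ)) =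
      ∫⁻ x in Metric.ball 0 R, ∫⁻ h, ‖kDiff k f h x‖ₑ ^ q *
        ENNReal.ofReal (‖h‖ ^ (-(n : ℝ) - σ)) := by
    rw [← lintegral_lintegral_swap (f := fun h x => ‖kDiff k f h x‖ₑ ^ q *
        ENNReal.ofReal (‖h‖ ^ (-(n : ℝ) - σ))) hmeas.aemeasurable]
    refine lintegral_congr fun h => ?_
    rw [lintegral_mul_const _ (measurable_enorm_kDiff_rpow k hf q h)]
  rw [hswap]
  have hle : ∀ a : ℝ≥0∞, a ≤ 1 + a ^ (r / q) := by
    intro a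
    rcases le_total a 1 with ha | ha
    · exact ha.trans le_self_add
    · refine le_trans ?_ le_add_self
      conv_lhs => rw [← ENNReal.rpow_one a]
      exact ENNReal.rpow_le_rpow_of_exponent_le ha ((one_le_div hq).2 hr)
  refine ((lintegral_mono fun x => hle _).trans_lt ?_).ne
  rw [lintegral_add_left measurable_const, setLIntegral_one]
  exact ENNReal.add_lt_top.2 ⟨measure_ball_lt_top,
    (setLIntegral_le_lintegral _ _).trans_lt hpow.lt_top⟩

/-- strong-type "defect": supercritical Gagliardo-type finiteness forces
`f` to be a polynomial of degree at most `k-1`. -/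
theorem statement9 (n k : ℕ) (hn : 0 < n) (hk : 0 < k) (q s r : ℝ)
    (hq : 0 < q) (hs : 0 < s) (hr : q ≤ r) (hsq : (k : ℝ) ≤ s * min 1 q)
    (f : En n → ℝ) (hf : Measurable f)
    (hfin : (∫⁻ x, (∫⁻ h, ENNReal.ofReal
        (|kDiff k f h x| ^ q * ‖h‖ ^ (-(n : ℝ) - s * q))) ^ (r / q)) ^ (1 / r) < ⊤) :
    ∃ P : MvPolynomial (Fin n) ℝ, P.totalDegree ≤ k - 1 ∧
      ∀ᵐ x : En n ∂volume, f x = MvPolynomial.eval (fun i => x i) P := by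
  have hσ : (k : ℝ) * max 1 q ≤ s * q := by
    rcases le_total 1 q with h | h
    · rw [min_eq_left h, mul_one] at hsq
      rw [max_eq_right h]
      exact mul_le_mul_of_nonneg_right hsq hq.le
    · rw [min_eq_right h] at hsq
      rwa [max_eq_left h, mul_one]
  exact exists_mvPolynomial_of_ae_kDiff_eq_zero hk hf
    (ae_kDiff_eq_zero_of_lintegral_ne_top hn hf hq hσ
      (lintegral_weighted_kDiff_ne_top hf hq hr hfin))
end

section
/- Let n ∈ ℕ, α ∈ {0,1/3,2/3}^n, k, ℓ ∈ ℕ with ℓ ≤ k, p, λ ∈ (0,∞), β ∈ ℝ∖{1}, and let f : ℝ^n → ℝ be infinitely differentiable with its ℓ-th derivative compactly supported. Then there exist constants 0 < c ≤ C < ∞ depending only on n, p, and β such that for every x belonging to the union of the cubes in D^α_{λ,β,k,ℓ}[f], there exists a cube Q_x ∈ D^α_{λ,β,k,ℓ}[f] containing x with c|Q_x|^{p(β−1)} ≤ ∑_{Q ∈ D^α_{λ,β,k,ℓ}[f]} |Q|^{p(β−1)} 1_Q(x) ≤ C|Q_x|^{p(β−1)}. -/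
open MeasureTheory Filter Set
open scoped ENNReal NNReal BigOperators Topology Classical

noncomputable section

open MeasureTheory Set
open scoped ENNReal Classical

variable {n : ℕ}

/-- The cube `2^j(m + [0,1)^n + (-1)^j α)` of the shifted dyadic grid `D^α`. -/
def dyCube (αv : Fin n → ℝ) (j : ℤ) (m : Fin n → ℤ) : Set (En n) :=
  {x | ∀ i, x i ∈ Ico ((2 : ℝ) ^ j * ((m i : ℝ) + (-1 : ℝ) ^ j * αv i))
      ((2 : ℝ) ^ j * ((m i : ℝ) + (-1 : ℝ) ^ j * αv i + 1))}

/-- The local approximation `E_k(f,S) = inf_{deg P ≤ k-1} ∫_S |f - P|`. -/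
def locApprox (k : ℕ) (f : En n → ℝ) (S : Set (En n)) : ℝ≥0∞ :=
  ⨅ (P : MvPolynomial (Fin n) ℝ) (_ : P.totalDegree ≤ k - 1),
    ∫⁻ y in S, ENNReal.ofReal |f y - MvPolynomial.eval (fun i => y i) P|

/-- The dyadic cube indexed by `(j,m)` of the grid `D^α` belongs to `D^α_{λ,β,k,ℓ}[f]`,
i.e. `E_k(f,Q) > λ |Q|^{β + ℓ/n}`. -/
def inGrid (αv : Fin n → ℝ) (k ℓ : ℕ) (lam β : ℝ) (f : En n → ℝ)
    (j : ℤ) (m : Fin n → ℤ) : Prop :=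
  ENNReal.ofReal lam * (volume (dyCube αv j m)) ^ (β + (ℓ : ℝ) / (n : ℝ))
    < locApprox k f (dyCube αv j m)

end

open MeasureTheory Set
open scoped ENNReal Classical

/-- The homogeneous polynomial function `y ↦ L (y - x, …, y - x)` is given by a polynomial. -/
lemma exists_mvPolynomial_eval_eq_diag {n i : ℕ}
    (L : ContinuousMultilinearMap ℝ (fun _ : Fin i => En n) ℝ) (x : En n) :
    ∃ P : MvPolynomial (Fin n) ℝ, P.totalDegree ≤ i ∧
      ∀ y : En n, MvPolynomial.eval (fun s => y s) P = L (fun _ => y - x) := by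
  refine ⟨∑ r : Fin i → Fin n, MvPolynomial.C (L fun s => EuclideanSpace.single (r s) (1 : ℝ)) *
    ∏ s, (MvPolynomial.X (r s) - MvPolynomial.C (x (r s))), ?_, fun y => ?_⟩
  · refine MvPolynomial.totalDegree_finsetSum_le fun r _ => ?_
    refine (MvPolynomial.totalDegree_mul _ _).trans ?_
    rw [MvPolynomial.totalDegree_C, zero_add]
    refine (MvPolynomial.totalDegree_finsetProd _ _).trans ?_
    refine (Finset.sum_le_card_nsmul _ _ 1 fun s _ => ?_).trans (by simp)
    exact (MvPolynomial.totalDegree_sub_C_le _ _).trans (MvPolynomial.totalDegree_X _).le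
  · have h : y - x = ∑ t, (y t - x t) • EuclideanSpace.single t (1 : ℝ) := by
      ext s
      simp [Finset.sum_apply, Pi.single_apply]
    conv_rhs => rw [h]
    rw [L.map_sum (fun _ t => (y t - x t) • EuclideanSpace.single t (1 : ℝ)), map_sum]
    refine Finset.sum_congr rfl fun r _ => ?_
    rw [L.map_smul_univ]
    simp [mul_comm]

/-- Taylor's theorem: a smooth function with bounded derivative of order `l + 1` is approximated
by a polynomial of degree at most `l`. -/
lemma exists_mvPolynomial_abs_sub_le {n l : ℕ} {f : En n → ℝ} (hf : ContDiff ℝ (⊤ : ℕ∞) f)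
    {M : ℝ} (hM : ∀ z, ‖iteratedFDeriv ℝ (l + 1) f z‖ ≤ M) (x : En n) :
    ∃ P : MvPolynomial (Fin n) ℝ, P.totalDegree ≤ l ∧
      ∀ y : En n, |f y - MvPolynomial.eval (fun s => y s) P| ≤ M * ‖y - x‖ ^ (l + 1) := by
  choose P hPd hP using fun i : ℕ =>
    exists_mvPolynomial_eval_eq_diag (iteratedFDeriv ℝ i f x) x
  have hM0 : 0 ≤ M := (norm_nonneg _).trans (hM x)
  refine ⟨∑ i ∈ Finset.range (l + 1), MvPolynomial.C ((i.factorial : ℝ)⁻¹) * P i, ?_, fun y => ?_⟩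
  · refine MvPolynomial.totalDegree_finsetSum_le fun i hi => ?_
    refine (MvPolynomial.totalDegree_mul _ _).trans ?_
    rw [MvPolynomial.totalDegree_C, zero_add]
    exact (hPd i).trans (Nat.lt_succ_iff.1 (Finset.mem_range.1 hi))
  · have h := map_add_eq_sum_add_integral_iteratedFDeriv (f := f) (x := x) (y := y - x) (n := l)
      fun t _ => (hf.of_le (by exact_mod_cast le_top)).contDiffAt
    rw [add_sub_cancel] at h
    have hI : ‖∫ t in (0 : ℝ)..1, (1 - t) ^ l •
        iteratedFDeriv ℝ (l + 1) f (x + t • (y - x)) (fun _ => y - x)‖ ≤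
        M * ‖y - x‖ ^ (l + 1) * |(1 : ℝ) - 0| := by
      refine intervalIntegral.norm_integral_le_of_norm_le_const fun t ht => ?_
      rw [uIoc_of_le zero_le_one] at ht
      rw [norm_smul]
      have h1 : ‖(1 - t) ^ l‖ ≤ 1 := by
        rw [norm_pow, Real.norm_eq_abs]
        exact pow_le_one₀ (abs_nonneg _) (abs_le.2 ⟨by linarith [ht.2], by linarith [ht.1]⟩)
      have h2 : ‖iteratedFDeriv ℝ (l + 1) f (x + t • (y - x)) (fun _ => y - x)‖ ≤
          M * ‖y - x‖ ^ (l + 1) := by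
        refine (ContinuousMultilinearMap.le_opNorm _ _).trans ?_
        rw [Finset.prod_const, Finset.card_univ, Fintype.card_fin]
        gcongr
        exact hM _
      exact (mul_le_of_le_one_left (norm_nonneg _) h1).trans h2
    rw [h]
    simp only [map_sum, map_mul, MvPolynomial.eval_C, hP, smul_eq_mul, add_sub_cancel_left]
    rw [abs_mul]
    have h3 : |((l.factorial : ℝ))⁻¹| ≤ 1 := by
      rw [abs_of_nonneg (by positivity)]
      exact inv_le_one_of_one_le₀ (by exact_mod_cast l.factorial_pos)
    refine (mul_le_of_le_one_left (abs_nonneg _) h3).trans ?_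
    simpa using hI

lemma volume_dyCube {n : ℕ} (αv : Fin n → ℝ) (j : ℤ) (m : Fin n → ℤ) :
    volume (dyCube αv j m) = ENNReal.ofReal ((2 : ℝ) ^ ((j : ℝ) * n)) := by
  have h : dyCube αv j m = (WithLp.ofLp : En n → Fin n → ℝ) ⁻¹'
      (Set.pi univ fun i => Ico ((2 : ℝ) ^ j * ((m i : ℝ) + (-1 : ℝ) ^ j * αv i))
        ((2 : ℝ) ^ j * ((m i : ℝ) + (-1 : ℝ) ^ j * αv i + 1))) := by
    ext x
    simp [dyCube]
  rw [h, (PiLp.volume_preserving_ofLp (Fin n)).measure_preimage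
    (MeasurableSet.univ_pi fun i => measurableSet_Ico).nullMeasurableSet, Real.volume_pi_Ico]
  have h2 : ∀ a : ℝ, (2 : ℝ) ^ j * (a + 1) - (2 : ℝ) ^ j * a = 2 ^ j := fun a => by ring
  simp only [h2, Finset.prod_const, Finset.card_univ, Fintype.card_fin]
  rw [← ENNReal.ofReal_pow (by positivity), Real.rpow_mul (by norm_num), Real.rpow_intCast,
    Real.rpow_natCast]

lemma volume_dyCube_rpow {n : ℕ} (αv : Fin n → ℝ) (j : ℤ) (m : Fin n → ℤ) (s : ℝ) :
    volume (dyCube αv j m) ^ s = ENNReal.ofReal ((2 : ℝ) ^ ((j : ℝ) * n * s)) := by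
  rw [volume_dyCube, ENNReal.ofReal_rpow_of_pos (by positivity), ← Real.rpow_mul (by norm_num)]

lemma norm_sub_le_of_mem_dyCube {n : ℕ} {αv : Fin n → ℝ} {j : ℤ} {m : Fin n → ℤ} {x y : En n}
    (hx : x ∈ dyCube αv j m) (hy : y ∈ dyCube αv j m) : ‖y - x‖ ≤ n * (2 : ℝ) ^ (j : ℝ) := by
  rw [Real.rpow_intCast]
  have h : y - x = ∑ t, (y t - x t) • EuclideanSpace.single t (1 : ℝ) := by
    ext s
    simp [Finset.sum_apply, Pi.single_apply]
  rw [h]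
  refine (norm_sum_le_of_le (f := fun t => (y t - x t) • EuclideanSpace.single t (1 : ℝ))
    (n := fun _ => (2 : ℝ) ^ j) _ fun t _ => ?_).trans (by simp)
  have h2 : ‖(y t - x t) • EuclideanSpace.single t (1 : ℝ)‖ = |y t - x t| := by
    rw [norm_smul]
    simp
  rw [h2, abs_le]
  obtain ⟨h3, h4⟩ := hx t
  obtain ⟨h5, h6⟩ := hy t
  constructor <;> linarith

/-- The cube of a given generation containing a given point is unique. -/
lemma eq_of_mem_dyCube {n : ℕ} {αv : Fin n → ℝ} {j : ℤ} {m m' : Fin n → ℤ} {x : En n}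
    (hx : x ∈ dyCube αv j m) (hx' : x ∈ dyCube αv j m') : m = m' := by
  funext i
  obtain ⟨h1, h2⟩ := hx i
  obtain ⟨h3, h4⟩ := hx' i
  have h2j : (0 : ℝ) < 2 ^ j := by positivity
  have h5 := lt_of_mul_lt_mul_left (h1.trans_lt h4) h2j.le
  have h6 := lt_of_mul_lt_mul_left (h3.trans_lt h2) h2j.le
  have h7 : (m i : ℝ) < m' i + 1 := by linarith
  have h8 : (m' i : ℝ) < m i + 1 := by linarith
  norm_cast at h7 h8
  omega

/-- Cubes in the level set satisfy a uniform bound on their size. -/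
lemma exists_rpow_lt_of_inGrid {n : ℕ} (hn : 0 < n) {k ℓ : ℕ} (hℓ : 0 < ℓ) (hℓk : ℓ ≤ k) {lam : ℝ}
    (hlam : 0 < lam) {f : En n → ℝ} (hf : ContDiff ℝ (⊤ : ℕ∞) f)
    (hfc : HasCompactSupport (iteratedFDeriv ℝ ℓ f)) (αv : Fin n → ℝ) (β : ℝ) :
    ∃ K : ℝ, ∀ (j : ℤ) (m : Fin n → ℤ), (dyCube αv j m).Nonempty → inGrid αv k ℓ lam β f j m →
      (2 : ℝ) ^ ((j : ℝ) * (n * (β - 1))) < K := by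
  obtain ⟨l, rfl⟩ : ∃ l, ℓ = l + 1 := ⟨ℓ - 1, by omega⟩
  have hcont : Continuous (iteratedFDeriv ℝ (l + 1) f) :=
    hf.continuous_iteratedFDeriv (by exact_mod_cast le_top)
  obtain ⟨M, hM⟩ := hfc.exists_bound_of_continuous hcont
  refine ⟨M * (n : ℝ) ^ (l + 1) / lam, fun j m ⟨x, hx⟩ h => ?_⟩
  have hM0 : 0 ≤ M := (norm_nonneg _).trans (hM x)
  obtain ⟨P, hPd, hP⟩ := exists_mvPolynomial_abs_sub_le hf hM x
  have hE : locApprox k f (dyCube αv j m) ≤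
      ENNReal.ofReal (M * (n * (2 : ℝ) ^ (j : ℝ)) ^ (l + 1)) * volume (dyCube αv j m) := by
    refine (iInf₂_le P (by omega)).trans ?_
    rw [← setLIntegral_const]
    refine setLIntegral_mono measurable_const fun y hy => ENNReal.ofReal_le_ofReal ?_
    refine (hP y).trans ?_
    gcongr
    exact norm_sub_le_of_mem_dyCube hx hy
  have h' := h.trans_le hE
  rw [volume_dyCube_rpow, volume_dyCube, ← ENNReal.ofReal_mul hlam.le,
    ← ENNReal.ofReal_mul (by positivity)] at h'
  have h'' := (ENNReal.ofReal_lt_ofReal_iff_of_nonneg (by positivity)).1 h'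
  rw [lt_div_iff₀ hlam]
  have hn0 : (n : ℝ) ≠ 0 := by positivity
  have e1 : (j : ℝ) * n * (β + ((l + 1 : ℕ) : ℝ) / n) =
      (j : ℝ) * (n * (β - 1)) + (j * ((l + 1 : ℕ) : ℝ) + j * n) := by
    field_simp
    ring
  have hpos : (0 : ℝ) < (2 : ℝ) ^ ((j : ℝ) * ((l + 1 : ℕ) : ℝ) + j * n) := by positivity
  refine lt_of_mul_lt_mul_right (a := (2 : ℝ) ^ ((j : ℝ) * ((l + 1 : ℕ) : ℝ) + j * n)) ?_ hpos.le
  rw [e1, Real.rpow_add (by norm_num)] at h''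
  refine lt_of_eq_of_lt (by ring) (h''.trans_eq ?_)
  rw [mul_pow, Real.rpow_add (by norm_num), Real.rpow_mul (by norm_num) (j : ℝ) ((l + 1 : ℕ) : ℝ),
    Real.rpow_natCast]
  ring

/-- A nonempty set of integers on which `j ↦ 2 ^ (j * d)` is bounded has an element dominating
all others. -/
lemma exists_extremal_int {d K : ℝ} (hd : d ≠ 0) {S : ℤ → Prop} (hS : ∃ j, S j)
    (hK : ∀ j, S j → (2 : ℝ) ^ ((j : ℝ) * d) < K) :
    ∃ j₀, S j₀ ∧ ∀ j, S j → (j : ℝ) * d = j₀ * d - |((j - j₀ : ℤ) : ℝ)| * |d| := by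
  have hK' : ∀ j, S j → (j : ℝ) * d < Real.logb 2 K := fun j hj =>
    (Real.lt_logb_iff_rpow_lt (by norm_num) ((by positivity : (0 : ℝ) < _).trans (hK j hj))).2
      (hK j hj)
  rcases lt_or_gt_of_ne hd with hd | hd
  · obtain ⟨j₀, h1, h2⟩ := Int.exists_least_of_bdd (P := S)
      ⟨⌊Real.logb 2 K / d⌋, fun j hj => by
        have := (div_lt_iff_of_neg hd).2 (hK' j hj)
        exact Int.floor_le_iff.2 (by linarith)⟩ hS
    refine ⟨j₀, h1, fun j hj => ?_⟩
    have : (j₀ : ℝ) ≤ j := by exact_mod_cast h2 j hj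
    push_cast
    rw [abs_of_neg hd, abs_of_nonneg (by linarith)]
    ring
  · obtain ⟨j₀, h1, h2⟩ := Int.exists_greatest_of_bdd (P := S)
      ⟨⌈Real.logb 2 K / d⌉, fun j hj => by
        have := (lt_div_iff₀ hd).2 (hK' j hj)
        exact Int.le_ceil_iff.2 (by linarith)⟩ hS
    refine ⟨j₀, h1, fun j hj => ?_⟩
    have : (j : ℝ) ≤ j₀ := by exact_mod_cast h2 j hj
    push_cast
    rw [abs_of_pos hd, abs_of_nonpos (by linarith)]
    ring

lemma summable_two_rpow_neg_abs {θ : ℝ} (hθ : 0 < θ) :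
    Summable fun i : ℤ => (2 : ℝ) ^ (-(|(i : ℝ)| * θ)) := by
  have hr : (2 : ℝ) ^ (-θ) < 1 := Real.rpow_lt_one_of_one_lt_of_neg (by norm_num) (by linarith)
  have h : Summable fun i : ℕ => (2 : ℝ) ^ (-((i : ℝ) * θ)) := by
    refine (summable_geometric_of_lt_one (by positivity) hr).congr fun i => ?_
    rw [← Real.rpow_natCast, ← Real.rpow_mul (by norm_num)]
    ring_nf
  refine Summable.of_nat_of_neg ?_ ?_ <;> simpa using h

/-- sparseness of the dyadic cubes in the level set
`D^α_{λ,β,k,ℓ}[f]`; the constants depend only on `n`, `p`, `β`. -/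
theorem statement10 (n : ℕ) (hn : 0 < n) (p β : ℝ) (hp : 0 < p) (hβ : β ≠ 1) :
    ∃ c C : ℝ, 0 < c ∧ c ≤ C ∧
      ∀ (k ℓ : ℕ), 0 < ℓ → ℓ ≤ k →
      ∀ αv : Fin n → ℝ, (∀ i, αv i ∈ ({0, 1/3, 2/3} : Set ℝ)) →
      ∀ lam : ℝ, 0 < lam →
      ∀ f : En n → ℝ, ContDiff ℝ (⊤ : ℕ∞) f → HasCompactSupport (iteratedFDeriv ℝ ℓ f) →
      ∀ x : En n,
        (∃ (j : ℤ) (m : Fin n → ℤ), inGrid αv k ℓ lam β f j m ∧ x ∈ dyCube αv j m) →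
        ∃ (j₀ : ℤ) (m₀ : Fin n → ℤ), inGrid αv k ℓ lam β f j₀ m₀ ∧ x ∈ dyCube αv j₀ m₀ ∧
          ENNReal.ofReal c * (volume (dyCube αv j₀ m₀)) ^ (p * (β - 1))
            ≤ (∑' (j : ℤ) (m : Fin n → ℤ),
                if inGrid αv k ℓ lam β f j m ∧ x ∈ dyCube αv j m then
                  (volume (dyCube αv j m)) ^ (p * (β - 1)) else 0) ∧
          (∑' (j : ℤ) (m : Fin n → ℤ),
              if inGrid αv k ℓ lam β f j m ∧ x ∈ dyCube αv j m then
                (volume (dyCube αv j m)) ^ (p * (β - 1)) else 0)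
            ≤ ENNReal.ofReal C * (volume (dyCube αv j₀ m₀)) ^ (p * (β - 1)) := by
  set s : ℝ := p * (β - 1) with hs
  have hβ' : β - 1 ≠ 0 := sub_ne_zero.2 hβ
  have hn' : (0 : ℝ) < n := by exact_mod_cast hn
  have hθ : 0 < |n * (β - 1)| * p := by positivity
  have hsum := summable_two_rpow_neg_abs hθ
  refine ⟨1, ∑' i : ℤ, (2 : ℝ) ^ (-(|(i : ℝ)| * (|n * (β - 1)| * p))), one_pos, ?_, ?_⟩
  · simpa using hsum.le_tsum 0 fun i _ => by positivity
  intro k ℓ hℓ hℓk αv _ lam hlam f hf hfc x hx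
  obtain ⟨K, hK⟩ := exists_rpow_lt_of_inGrid hn hℓ hℓk hlam hf hfc αv β
  obtain ⟨j₀, ⟨m₀, hm₀⟩, hj₀⟩ := exists_extremal_int (d := n * (β - 1)) (K := K)
    (S := fun j => ∃ m, inGrid αv k ℓ lam β f j m ∧ x ∈ dyCube αv j m) (by positivity) hx
    (fun j ⟨m, hm, hxm⟩ => hK j m ⟨x, hxm⟩ hm)
  refine ⟨j₀, m₀, hm₀.1, hm₀.2, ?_, ?_⟩
  · rw [ENNReal.ofReal_one, one_mul]
    refine le_trans ?_ (ENNReal.le_tsum j₀)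
    refine le_trans ?_ (ENNReal.le_tsum m₀)
    rw [if_pos hm₀]
  · rw [ENNReal.ofReal_tsum_of_nonneg (fun i => by positivity) hsum, ← ENNReal.tsum_mul_right,
      ← (Equiv.subRight j₀).tsum_eq (fun i : ℤ =>
        ENNReal.ofReal ((2 : ℝ) ^ (-(|(i : ℝ)| * (|n * (β - 1)| * p)))) * _)]
    refine ENNReal.tsum_le_tsum fun j => ?_
    by_cases hj : ∃ m, inGrid αv k ℓ lam β f j m ∧ x ∈ dyCube αv j m
    · obtain ⟨m, hm⟩ := hj
      rw [tsum_eq_single m fun m' hm' => if_neg fun h => hm' (eq_of_mem_dyCube h.2 hm.2),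
        if_pos hm, volume_dyCube_rpow, volume_dyCube_rpow, ← ENNReal.ofReal_mul (by positivity),
        ← Real.rpow_add (by norm_num)]
      refine le_of_eq ?_
      congr 2
      have h := hj₀ j ⟨m, hm⟩
      rw [Equiv.subRight_apply, hs]
      linear_combination p * h
    · have h0 : ∀ m, ¬(inGrid αv k ℓ lam β f j m ∧ x ∈ dyCube αv j m) := not_exists.1 hj
      simp [h0]
end

section
/- Let n, k ∈ ℕ and let f : ℝ^n → ℝ be locally integrable, and suppose that to each ball B ⊂ ℝ^n a polynomial P_B of degree at most k−1 is assigned satisfying the moment conditions ∫_B (f(y) − P_B(y)) y^α dy = 0 for every multi-index α with |α| ≤ k−1. Then there exists a constant C depending only on n and k such that for almost every x ∈ ℝ^n the following holds: for every r ∈ (0,∞) and every ball B₁ with B₁ ⊂ B(x,r) ⊂ 3B₁, one has |f(x) − P_{B₁}(x)| ≤ C ∑_{j=0}^∞ ⨍_{B(x,2^{−j}r)} |f(y) − P_{B(x,2^{−j}r)}(y)| dy. -/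
open MeasureTheory Set
open scoped ENNReal BigOperators

/-- A linear map on a finite-dimensional real inner product space is bounded. -/
lemma InnerProductSpace.Core.exists_norm_sq_le {V F : Type*} [AddCommGroup V] [Module ℝ V]
    [FiniteDimensional ℝ V] [NormedAddCommGroup F] [NormedSpace ℝ F]
    (core : InnerProductSpace.Core ℝ V) (T : V →ₗ[ℝ] F) :
    ∃ c : ℝ, 0 < c ∧ ∀ p, ‖T p‖ ^ 2 ≤ c * core.inner p p := by
  let _ : NormedAddCommGroup V := core.toNormedAddCommGroup
  let _ : InnerProductSpace ℝ V := InnerProductSpace.ofCore core.toCore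
  obtain ⟨c, hc, hT⟩ := T.toContinuousLinearMap.bound
  refine ⟨c ^ 2, by positivity, fun p => ?_⟩
  have h : ‖p‖ ^ 2 = core.inner p p := (real_inner_self_eq_norm_sq p).symm
  rw [← h, ← mul_pow]
  exact pow_le_pow_left₀ (norm_nonneg _) (hT p) 2

namespace MvPolynomial

/-- The polynomial function on Euclidean space attached to `Q`. -/
noncomputable def evalEn {n : ℕ} (Q : MvPolynomial (Fin n) ℝ) (y : En n) : ℝ := eval (fun i => y i) Q

lemma continuous_evalEn {n : ℕ} (Q : MvPolynomial (Fin n) ℝ) : Continuous Q.evalEn := by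
  have h : Continuous fun y : En n => fun i => y i := by fun_prop
  exact (MvPolynomial.continuous_eval Q).comp h

lemma integrableOn_evalEn_mul {n : ℕ} (Q R : MvPolynomial (Fin n) ℝ) (z : En n) (ρ : ℝ) :
    IntegrableOn (fun y => Q.evalEn y * R.evalEn y) (Metric.ball z ρ) volume :=
  (((Q.continuous_evalEn.mul R.continuous_evalEn).continuousOn.integrableOn_compact
    (isCompact_closedBall z ρ))).mono_set Metric.ball_subset_closedBall

lemma eq_zero_of_evalEn_eq_zero_of_mem_ball {n : ℕ} {Q : MvPolynomial (Fin n) ℝ}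
    (h : ∀ y ∈ Metric.ball (0 : En n) 1, Q.evalEn y = 0) : Q = 0 := by
  have hc : Continuous fun v : Fin n → ℝ => (WithLp.toLp 2 v : En n) := by fun_prop
  have hnhds : (fun v : Fin n → ℝ => (WithLp.toLp 2 v : En n)) ⁻¹' Metric.ball 0 1 ∈ nhds 0 :=
    (Metric.isOpen_ball.preimage hc).mem_nhds (by simp)
  obtain ⟨ε, hε, hsub⟩ := Metric.mem_nhds_iff.1 hnhds
  refine funext_set (fun _ => Metric.ball 0 ε) (fun _ => ?_) fun v hv => ?_
  · exact infinite_of_mem_nhds 0 (Metric.ball_mem_nhds 0 hε)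
  · rw [map_zero]
    refine h (WithLp.toLp 2 v) (hsub ?_)
    rwa [ball_pi _ hε]

lemma eq_zero_of_integral_sq_eq_zero {n : ℕ} {Q : MvPolynomial (Fin n) ℝ}
    (h : ∫ y in Metric.ball (0 : En n) 1, Q.evalEn y * Q.evalEn y = 0) : Q = 0 := by
  rw [setIntegral_eq_zero_iff_of_nonneg_ae
    (Filter.Eventually.of_forall fun y => mul_self_nonneg _)
    (integrableOn_evalEn_mul Q Q 0 1)] at h
  have := Measure.eqOn_open_of_ae_eq h Metric.isOpen_ball
    (Q.continuous_evalEn.mul Q.continuous_evalEn).continuousOn continuousOn_const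
  exact eq_zero_of_evalEn_eq_zero_of_mem_ball fun y hy => mul_self_eq_zero.1 (this hy)

/-- On polynomials of bounded degree, the sup norm on the closed ball of radius `3` is controlled
by the `L²` norm on the unit ball. -/
lemma exists_sq_evalEn_le_integral (n m : ℕ) : ∃ M : ℝ, 0 < M ∧
    ∀ Q : MvPolynomial (Fin n) ℝ, Q.totalDegree ≤ m → ∀ y : En n, ‖y‖ ≤ 3 →
      Q.evalEn y ^ 2 ≤ M * ∫ u in Metric.ball (0 : En n) 1, Q.evalEn u * Q.evalEn u := by
  let V := restrictTotalDegree (Fin n) ℝ m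
  let core : InnerProductSpace.Core ℝ V :=
    { inner := fun p q => ∫ u in Metric.ball (0 : En n) 1, p.1.evalEn u * q.1.evalEn u
      conj_inner_symm := fun p q => by simp [mul_comm]
      re_inner_nonneg := fun p => integral_nonneg fun u => mul_self_nonneg _
      add_left := fun p q r => by
        rw [← integral_add (integrableOn_evalEn_mul _ _ _ _) (integrableOn_evalEn_mul _ _ _ _)]
        simp [evalEn, add_mul]
      smul_left := fun p q c => by
        simp [evalEn, ← integral_const_mul, mul_assoc]
      definite := fun p hp => Subtype.ext (eq_zero_of_integral_sq_eq_zero hp) }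
  let T : V →ₗ[ℝ] C(Metric.closedBall (0 : En n) 3, ℝ) :=
    { toFun := fun p => ⟨fun y => p.1.evalEn y, by
        exact p.1.continuous_evalEn.comp continuous_subtype_val⟩
      map_add' := fun p q => by ext; simp [evalEn]
      map_smul' := fun c p => by ext; simp [evalEn] }
  have : CompactSpace (Metric.closedBall (0 : En n) 3) :=
    isCompact_iff_compactSpace.1 (isCompact_closedBall _ _)
  obtain ⟨c, hc, hT⟩ := core.exists_norm_sq_le T
  refine ⟨c, hc, fun Q hQ y hy => ?_⟩
  let p : V := ⟨Q, (mem_restrictTotalDegree _ _ _).2 hQ⟩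
  refine le_trans ?_ (hT p)
  rw [← sq_abs]
  gcongr
  exact (T p).norm_coe_le_norm ⟨y, by simpa using hy⟩

/-- Precomposition of a polynomial with `u ↦ ρ u + z`. -/
lemma exists_evalEn_comp_affine {n : ℕ} (Q : MvPolynomial (Fin n) ℝ) (z : En n) (ρ : ℝ) :
    ∃ R : MvPolynomial (Fin n) ℝ, R.totalDegree ≤ Q.totalDegree ∧
      ∀ u : En n, R.evalEn u = Q.evalEn (ρ • u + z) := by
  refine ⟨∑ d ∈ Q.support, C (Q.coeff d) * ∏ i, (C ρ * X i + C (z i)) ^ d i, ?_, fun u => ?_⟩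
  · refine totalDegree_finsetSum_le fun d hd => (totalDegree_mul _ _).trans ?_
    rw [totalDegree_C, zero_add]
    refine ((totalDegree_finsetProd _ _).trans ?_).trans (le_totalDegree hd)
    rw [Finsupp.sum_fintype _ _ (fun _ => rfl)]
    refine Finset.sum_le_sum fun i _ => (totalDegree_pow _ _).trans ?_
    have : (C ρ * X i + C (z i) : MvPolynomial (Fin n) ℝ).totalDegree ≤ 1 := by
      refine (totalDegree_add _ _).trans (max_le ((totalDegree_mul _ _).trans ?_) (by simp))
      simp
    simpa using Nat.mul_le_mul_left (d i) this
  · simp only [evalEn, map_sum, map_mul, map_prod, map_pow, map_add, eval_C, eval_X]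
    rw [eval_eq']
    simp

open scoped Pointwise in
/-- Scale-invariant comparison of the sup norm and the `L²` norm of polynomials on balls. -/
lemma exists_sq_evalEn_le_average (n m : ℕ) : ∃ M : ℝ, 0 < M ∧
    ∀ Q : MvPolynomial (Fin n) ℝ, Q.totalDegree ≤ m → ∀ (z : En n) (ρ : ℝ), 0 < ρ →
      ∀ y : En n, ‖y - z‖ ≤ 3 * ρ →
      Q.evalEn y ^ 2 ≤ M * (volume.real (Metric.ball z ρ))⁻¹ *
        ∫ u in Metric.ball z ρ, Q.evalEn u * Q.evalEn u := by
  obtain ⟨M, hM, H⟩ := exists_sq_evalEn_le_integral n m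
  have hv : 0 < volume.real (Metric.ball (0 : En n) 1) :=
    ENNReal.toReal_pos (Metric.measure_ball_pos _ _ one_pos).ne' measure_ball_lt_top.ne
  refine ⟨M * volume.real (Metric.ball (0 : En n) 1), by positivity,
    fun Q hQ z ρ hρ y hy => ?_⟩
  obtain ⟨R, hR, hRQ⟩ := exists_evalEn_comp_affine Q z ρ
  have h := H R (hR.trans hQ) (ρ⁻¹ • (y - z)) (by
    rw [norm_smul, norm_inv, Real.norm_of_nonneg hρ.le, inv_mul_le_iff₀ hρ]
    linarith)
  have hvol : volume.real (Metric.ball z ρ) = ρ ^ n * volume.real (Metric.ball (0 : En n) 1) := by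
    rw [Measure.real, Measure.addHaar_ball_of_pos _ _ hρ, ENNReal.toReal_mul,
      ENNReal.toReal_ofReal (by positivity), finrank_euclideanSpace_fin, Measure.real]
  have hint : ∫ u in Metric.ball (0 : En n) 1, R.evalEn u * R.evalEn u =
      (ρ ^ n)⁻¹ * ∫ u in Metric.ball z ρ, Q.evalEn u * Q.evalEn u := by
    simp_rw [hRQ]
    rw [Measure.setIntegral_comp_smul_of_pos volume
      (fun u : En n => Q.evalEn (u + z) * Q.evalEn (u + z)) _ hρ, finrank_euclideanSpace_fin,
      smul_eq_mul]
    congr 1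
    have : ρ • Metric.ball (0 : En n) 1 = (fun u => u + z) ⁻¹' Metric.ball z ρ := by
      rw [smul_ball hρ.ne']
      ext u
      simp [abs_of_pos hρ, dist_eq_norm]
    rw [this]
    exact (measurePreserving_add_right volume z).setIntegral_preimage_emb
      (measurableEmbedding_addRight z) (fun u => Q.evalEn u * Q.evalEn u) _
  rw [hRQ, smul_inv_smul₀ hρ.ne', sub_add_cancel, hint] at h
  refine h.trans_eq ?_
  rw [hvol]
  field_simp

end MvPolynomial

open MvPolynomial in
/-- If `f - P` is orthogonal to all monomials of degree at most `m` on a ball, it is orthogonal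
to all polynomials of degree at most `m`. -/
lemma setIntegral_mul_evalEn_eq_zero {n m : ℕ} {g : En n → ℝ} {z : En n} {ρ : ℝ}
    (hg : LocallyIntegrable g volume)
    (hmom : ∀ α : Fin n → ℕ, (∑ i, α i) ≤ m →
      ∫ y in Metric.ball z ρ, g y * ∏ i, (y i) ^ (α i) = 0)
    {R : MvPolynomial (Fin n) ℝ} (hR : R.totalDegree ≤ m) :
    ∫ y in Metric.ball z ρ, g y * R.evalEn y = 0 := by
  have hint : ∀ d ∈ R.support, IntegrableOn
      (fun y : En n => R.coeff d * (g y * ∏ i, (y i) ^ (d i))) (Metric.ball z ρ) volume := by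
    intro d _
    have hc : Continuous fun y : En n => ∏ i, (y i) ^ (d i) := by fun_prop
    exact ((((hg.integrableOn_isCompact (isCompact_closedBall z ρ)).mul_continuousOn
      hc.continuousOn (isCompact_closedBall z ρ)).mono_set Metric.ball_subset_closedBall)).const_mul _
  have hsum : ∀ y : En n, g y * R.evalEn y =
      ∑ d ∈ R.support, R.coeff d * (g y * ∏ i, (y i) ^ (d i)) := by
    intro y
    rw [evalEn, eval_eq', Finset.mul_sum]
    exact Finset.sum_congr rfl fun d _ => by ring
  simp_rw [hsum]
  rw [integral_finsetSum _ hint]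
  refine Finset.sum_eq_zero fun d hd => ?_
  rw [integral_const_mul, hmom d, mul_zero]
  refine le_trans ?_ ((le_totalDegree hd).trans hR)
  rw [Finsupp.sum_fintype _ _ (fun _ => rfl)]

open MvPolynomial in
/-- Near-best approximation: the polynomial `P` with the same moments as `f` on a ball satisfies
`|P - Q| ≤ M ⨍ |f - Q|` on the three times larger closed ball, for each competitor `Q`. -/
lemma exists_abs_evalEn_sub_le_average (n m : ℕ) : ∃ M : ℝ, 0 < M ∧
    ∀ f : En n → ℝ, LocallyIntegrable f volume → ∀ (z : En n) (ρ : ℝ), 0 < ρ →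
    ∀ P : MvPolynomial (Fin n) ℝ, P.totalDegree ≤ m →
    (∀ α : Fin n → ℕ, (∑ i, α i) ≤ m →
      ∫ y in Metric.ball z ρ, (f y - P.evalEn y) * ∏ i, (y i) ^ (α i) = 0) →
    ∀ Q : MvPolynomial (Fin n) ℝ, Q.totalDegree ≤ m → ∀ x : En n, ‖x - z‖ ≤ 3 * ρ →
      |P.evalEn x - Q.evalEn x| ≤ M * (volume.real (Metric.ball z ρ))⁻¹ *
        ∫ y in Metric.ball z ρ, |f y - Q.evalEn y| := by
  obtain ⟨M, hM, H⟩ := exists_sq_evalEn_le_average n m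
  refine ⟨M, hM, fun f hf z ρ hρ P hP hmom Q hQ x hx => ?_⟩
  set R := P - Q with hRdef
  have hR : R.totalDegree ≤ m := (totalDegree_sub _ _).trans (max_le hP hQ)
  have hReval : ∀ y, R.evalEn y = P.evalEn y - Q.evalEn y := fun y => by simp [hRdef, evalEn]
  have hfP : LocallyIntegrable (fun y => f y - P.evalEn y) volume :=
    hf.sub P.continuous_evalEn.locallyIntegrable
  have hfQ : LocallyIntegrable (fun y => f y - Q.evalEn y) volume :=
    hf.sub Q.continuous_evalEn.locallyIntegrable
  have hmul : ∀ g : En n → ℝ, LocallyIntegrable g volume →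
      IntegrableOn (fun y => g y * R.evalEn y) (Metric.ball z ρ) volume := fun g hg =>
    ((hg.integrableOn_isCompact (isCompact_closedBall z ρ)).mul_continuousOn
      R.continuous_evalEn.continuousOn (isCompact_closedBall z ρ)).mono_set
        Metric.ball_subset_closedBall
  obtain ⟨y₀, hy₀, hmax⟩ := (isCompact_closedBall z (3 * ρ)).exists_isMaxOn
    ⟨z, by simp; positivity⟩ R.continuous_evalEn.abs.continuousOn
  set S := |R.evalEn y₀| with hS
  set I := ∫ y in Metric.ball z ρ, |f y - Q.evalEn y| with hI
  have hsq : ∫ y in Metric.ball z ρ, R.evalEn y * R.evalEn y ≤ I * S := by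
    have h0 := setIntegral_mul_evalEn_eq_zero hfP hmom hR
    have h1 : ∫ y in Metric.ball z ρ, R.evalEn y * R.evalEn y =
        ∫ y in Metric.ball z ρ, (f y - Q.evalEn y) * R.evalEn y := by
      rw [← sub_zero (∫ y in Metric.ball z ρ, (f y - Q.evalEn y) * R.evalEn y), ← h0,
        ← integral_sub (hmul _ hfQ) (hmul _ hfP)]
      refine integral_congr_ae (Filter.Eventually.of_forall fun y => ?_)
      simp only [hReval]
      ring
    rw [h1, hI, ← integral_mul_const]
    have hQabs : IntegrableOn (fun y => |f y - Q.evalEn y|) (Metric.ball z ρ) volume :=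
      (((hfQ.integrableOn_isCompact (isCompact_closedBall z ρ)).mono_set
        Metric.ball_subset_closedBall)).abs
    refine setIntegral_mono_on (hmul _ hfQ) (hQabs.mul_const _) measurableSet_ball fun y hy => ?_
    refine (le_abs_self _).trans ?_
    rw [abs_mul]
    refine mul_le_mul_of_nonneg_left (hmax ?_) (abs_nonneg _)
    exact Metric.closedBall_subset_closedBall (by linarith) (Metric.ball_subset_closedBall hy)
  have hI0 : 0 ≤ I := integral_nonneg fun y => abs_nonneg _
  have hS0 : 0 ≤ S := abs_nonneg _
  have hbound : S ^ 2 ≤ M * (volume.real (Metric.ball z ρ))⁻¹ * (I * S) := by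
    rw [hS, sq_abs]
    refine (H R hR z ρ hρ y₀ (by simpa [dist_eq_norm] using hy₀)).trans ?_
    gcongr
  have hxS : |P.evalEn x - Q.evalEn x| ≤ S := by
    rw [← hReval]
    exact hmax (show x ∈ Metric.closedBall z (3 * ρ) by simpa [dist_eq_norm] using hx)
  refine hxS.trans ?_
  rcases hS0.eq_or_lt with h | h
  · rw [← h]
    positivity
  · refine le_of_mul_le_mul_right ?_ h
    linarith [hbound, sq S]

open MvPolynomial in
/-- Comparison of the approximating polynomial on a ball with the average oscillation around a
polynomial over a larger set of comparable measure. -/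
lemma exists_ofReal_abs_evalEn_sub_le (n m : ℕ) : ∃ M : ℝ, 0 < M ∧
    ∀ f : En n → ℝ, LocallyIntegrable f volume → ∀ (z : En n) (ρ : ℝ), 0 < ρ →
    ∀ P : MvPolynomial (Fin n) ℝ, P.totalDegree ≤ m →
    (∀ α : Fin n → ℕ, (∑ i, α i) ≤ m →
      ∫ y in Metric.ball z ρ, (f y - P.evalEn y) * ∏ i, (y i) ^ (α i) = 0) →
    ∀ Q : MvPolynomial (Fin n) ℝ, Q.totalDegree ≤ m → ∀ x : En n, ‖x - z‖ ≤ 3 * ρ →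
    ∀ s : Set (En n), Metric.ball z ρ ⊆ s →
      volume s ≤ 3 ^ n * volume (Metric.ball z ρ) →
      ENNReal.ofReal |P.evalEn x - Q.evalEn x| ≤ ENNReal.ofReal M *
        ((volume s)⁻¹ * ∫⁻ y in s, ENNReal.ofReal |f y - Q.evalEn y|) := by
  obtain ⟨M, hM, H⟩ := exists_abs_evalEn_sub_le_average n m
  refine ⟨M * 3 ^ n, by positivity, fun f hf z ρ hρ P hP hmom Q hQ x hx s hs hvol => ?_⟩
  have hv0 : volume (Metric.ball z ρ) ≠ 0 := (Metric.measure_ball_pos _ _ hρ).ne'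
  have hvt : volume (Metric.ball z ρ) ≠ ⊤ := measure_ball_lt_top.ne
  have hQint : IntegrableOn (fun y => f y - Q.evalEn y) (Metric.ball z ρ) volume :=
    ((hf.sub Q.continuous_evalEn.locallyIntegrable).integrableOn_isCompact
      (isCompact_closedBall z ρ)).mono_set Metric.ball_subset_closedBall
  have hinv : (volume (Metric.ball z ρ))⁻¹ ≤ 3 ^ n * (volume s)⁻¹ := by
    have h3 : (3 ^ n : ℝ≥0∞) * (3 ^ n)⁻¹ = 1 := ENNReal.mul_inv_cancel (by simp) (by finiteness)
    calc (volume (Metric.ball z ρ))⁻¹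
        = 3 ^ n * (3 ^ n * volume (Metric.ball z ρ))⁻¹ := by
          rw [ENNReal.mul_inv (Or.inr hvt) (Or.inr hv0), ← mul_assoc, h3, one_mul]
      _ ≤ 3 ^ n * (volume s)⁻¹ := by gcongr
  calc ENNReal.ofReal |P.evalEn x - Q.evalEn x|
      ≤ ENNReal.ofReal (M * (volume.real (Metric.ball z ρ))⁻¹ *
        ∫ y in Metric.ball z ρ, |f y - Q.evalEn y|) :=
        ENNReal.ofReal_le_ofReal (H f hf z ρ hρ P hP hmom Q hQ x hx)
    _ = ENNReal.ofReal M * ((volume (Metric.ball z ρ))⁻¹ *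
        ∫⁻ y in Metric.ball z ρ, ENNReal.ofReal |f y - Q.evalEn y|) := by
        rw [mul_assoc, ENNReal.ofReal_mul hM.le, ENNReal.ofReal_mul (by positivity),
          ofReal_integral_eq_lintegral_ofReal hQint.abs
            (Filter.Eventually.of_forall fun y => abs_nonneg _),
          ENNReal.ofReal_inv_of_pos (show 0 < volume.real (Metric.ball z ρ) from
            ENNReal.toReal_pos hv0 hvt), Measure.real, ENNReal.ofReal_toReal hvt]
    _ ≤ ENNReal.ofReal M * ((3 ^ n * (volume s)⁻¹) *
        ∫⁻ y in s, ENNReal.ofReal |f y - Q.evalEn y|) := by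
        gcongr
    _ = _ := by
        rw [ENNReal.ofReal_mul hM.le, ENNReal.ofReal_pow (by norm_num), ENNReal.ofReal_ofNat]
        ring

/-- Lebesgue differentiation along balls centred at the point. -/
lemma ae_tendsto_lintegral_ball_abs_sub {n : ℕ} {f : En n → ℝ} (hf : LocallyIntegrable f volume) :
    ∀ᵐ x : En n ∂volume, Filter.Tendsto (fun t : ℝ => (volume (Metric.ball x t))⁻¹ *
      ∫⁻ y in Metric.ball x t, ENNReal.ofReal |f y - f x|) (nhdsWithin 0 (Ioi 0)) (nhds 0) := by
  filter_upwards [(Besicovitch.vitaliFamily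
    (volume : Measure (En n))).ae_tendsto_lintegral_enorm_sub_div hf] with x hx
  refine (hx.comp (Besicovitch.tendsto_filterAt volume x)).congr' ?_
  filter_upwards [self_mem_nhdsWithin] with t ht
  have hae : (Metric.closedBall x t : Set (En n)) =ᵐ[volume] Metric.ball x t := by
    rw [← Metric.ball_union_sphere]
    exact union_ae_eq_left_of_ae_eq_empty
      (ae_eq_empty.2 (Measure.addHaar_sphere_of_ne_zero volume x (ne_of_gt ht)))
  simp only [Function.comp_apply]
  rw [measure_congr hae, setLIntegral_congr hae, ENNReal.div_eq_inv_mul]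
  simp only [← Real.enorm_eq_ofReal_abs]

/-- pointwise variant of a higher-order Poincaré inequality in terms of
minimizing polynomials on balls; the constant depends only on `n` and `k`. -/
theorem statement11 (n k : ℕ) (hn : 0 < n) (hk : 0 < k) :
    ∃ C : ℝ, 0 < C ∧
      ∀ f : En n → ℝ, LocallyIntegrable f volume →
      ∀ P : En n → ℝ → En n → ℝ,
        (∀ (z : En n) (ρ : ℝ), 0 < ρ →
          ∃ Q : MvPolynomial (Fin n) ℝ, Q.totalDegree ≤ k - 1 ∧
            ∀ y : En n, P z ρ y = MvPolynomial.eval (fun i => y i) Q) →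
        (∀ (z : En n) (ρ : ℝ), 0 < ρ → ∀ α : Fin n → ℕ, (∑ i, α i) ≤ k - 1 →
          ∫ y in Metric.ball z ρ, (f y - P z ρ y) * ∏ i, (y i) ^ (α i) = 0) →
        ∀ᵐ x : En n ∂volume, ∀ r : ℝ, 0 < r → ∀ (z₁ : En n) (ρ₁ : ℝ), 0 < ρ₁ →
          Metric.ball z₁ ρ₁ ⊆ Metric.ball x r →
          Metric.ball x r ⊆ Metric.ball z₁ (3 * ρ₁) →
          ENNReal.ofReal |f x - P z₁ ρ₁ x| ≤ ENNReal.ofReal C *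
            ∑' j : ℕ, (volume (Metric.ball x ((2 : ℝ) ^ (-(j : ℤ)) * r)))⁻¹ *
              ∫⁻ y in Metric.ball x ((2 : ℝ) ^ (-(j : ℤ)) * r),
                ENNReal.ofReal |f y - P x ((2 : ℝ) ^ (-(j : ℤ)) * r) y| := by
  obtain ⟨M, hM, H⟩ := exists_ofReal_abs_evalEn_sub_le n (k - 1)
  refine ⟨2 * M, by positivity, fun f hf P hpoly hmom => ?_⟩
  have key : ∀ (z : En n) (ρ : ℝ), 0 < ρ → ∀ g : En n → ℝ,
      (∃ Q : MvPolynomial (Fin n) ℝ, Q.totalDegree ≤ k - 1 ∧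
        ∀ y : En n, g y = MvPolynomial.eval (fun i => y i) Q) →
      ∀ x : En n, ‖x - z‖ ≤ 3 * ρ → ∀ s : Set (En n), Metric.ball z ρ ⊆ s →
      volume s ≤ 3 ^ n * volume (Metric.ball z ρ) →
      ENNReal.ofReal |P z ρ x - g x| ≤ ENNReal.ofReal M *
        ((volume s)⁻¹ * ∫⁻ y in s, ENNReal.ofReal |f y - g y|) := by
    rintro z ρ hρ g ⟨Q, hQ, hgQ⟩ x hx s hs hvol
    obtain ⟨R, hR, hPR⟩ := hpoly z ρ hρ
    have hmom' := hmom z ρ hρ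
    simp only [hPR, hgQ] at hmom' ⊢
    exact H f hf z ρ hρ R hR hmom' Q hQ x hx s hs hvol
  have hscale : ∀ (z : En n) (ρ c : ℝ), 0 < ρ → 0 ≤ c → c ≤ 3 →
      volume (Metric.ball z (c * ρ)) ≤ 3 ^ n * volume (Metric.ball z ρ) := by
    intro z ρ c hρ hc hc3
    calc volume (Metric.ball z (c * ρ)) ≤ volume (Metric.ball z (3 * ρ)) :=
          measure_mono (Metric.ball_subset_ball (by gcongr))
      _ = 3 ^ n * volume (Metric.ball z ρ) := by
          rw [Measure.addHaar_ball_mul_of_pos _ _ (by norm_num), finrank_euclideanSpace_fin,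
            ENNReal.ofReal_pow (by norm_num), ENNReal.ofReal_ofNat,
            Measure.addHaar_ball_center volume z]
  filter_upwards [ae_tendsto_lintegral_ball_abs_sub hf] with x hx r hr z₁ ρ₁ hρ₁ hsub₁ hsub₂
  set rad : ℕ → ℝ := fun j => (2 : ℝ) ^ (-(j : ℤ)) * r with hrad
  have hrad_pos : ∀ j, 0 < rad j := fun j => by positivity
  have hrad_zero : rad 0 = r := by simp [hrad]
  have hrad_succ : ∀ j, rad j = 2 * rad (j + 1) := fun j => by
    simp only [hrad, zpow_neg, zpow_natCast, pow_succ]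
    field_simp
  have hrad_tendsto : Filter.Tendsto rad Filter.atTop (nhdsWithin 0 (Ioi 0)) := by
    refine tendsto_nhdsWithin_iff.2 ⟨?_, Filter.Eventually.of_forall hrad_pos⟩
    have h := (tendsto_pow_atTop_nhds_zero_of_lt_one (r := (2 : ℝ)⁻¹) (by norm_num)
      (by norm_num)).mul_const r
    rw [zero_mul] at h
    refine h.congr fun j => ?_
    simp [hrad]
  set a : ℕ → ℝ≥0∞ := fun j => (volume (Metric.ball x (rad j)))⁻¹ *
    ∫⁻ y in Metric.ball x (rad j), ENNReal.ofReal |f y - P x (rad j) y| with ha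
  set b : ℕ → ℝ≥0∞ := fun j => (volume (Metric.ball x (rad j)))⁻¹ *
    ∫⁻ y in Metric.ball x (rad j), ENNReal.ofReal |f y - f x| with hb
  have htri : ∀ u v w : ℝ, ENNReal.ofReal |u - w| ≤
      ENNReal.ofReal |u - v| + ENNReal.ofReal |v - w| := fun u v w => by
    rw [← ENNReal.ofReal_add (abs_nonneg _) (abs_nonneg _)]
    exact ENNReal.ofReal_le_ofReal (abs_sub_le u v w)
  have hfirst : ENNReal.ofReal |P z₁ ρ₁ x - P x (rad 0) x| ≤ ENNReal.ofReal M * a 0 := by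
    refine key z₁ ρ₁ hρ₁ (P x (rad 0)) (hpoly _ _ (hrad_pos 0)) x ?_ _ ?_ ?_
    · have := hsub₂ (Metric.mem_ball_self hr)
      exact (mem_ball_iff_norm.1 this).le
    · rwa [hrad_zero]
    · rw [hrad_zero]
      exact (measure_mono hsub₂).trans (hscale z₁ ρ₁ 3 hρ₁ (by norm_num) le_rfl)
  have hstep : ∀ j, ENNReal.ofReal |P x (rad (j + 1)) x - P x (rad j) x| ≤
      ENNReal.ofReal M * a j := fun j => by
    refine key x _ (hrad_pos _) (P x (rad j)) (hpoly _ _ (hrad_pos j)) x ?_ _ ?_ ?_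
    · simpa using (hrad_pos _).le
    · exact Metric.ball_subset_ball (by rw [hrad_succ j]; linarith [hrad_pos (j + 1)])
    · rw [hrad_succ j]
      exact hscale _ _ _ (hrad_pos _) (by norm_num) (by norm_num)
  have hlast : ∀ j, ENNReal.ofReal |P x (rad j) x - f x| ≤ ENNReal.ofReal M * b j := fun j => by
    refine key x _ (hrad_pos _) (fun _ => f x) ⟨MvPolynomial.C (f x), by simp, by simp⟩ x ?_ _ subset_rfl ?_
    · simpa using (hrad_pos _).le
    · simpa using hscale x _ 1 (hrad_pos j) (by norm_num) (by norm_num)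
  have hchain : ∀ N, ENNReal.ofReal |P x (rad N) x - P z₁ ρ₁ x| ≤
      ENNReal.ofReal M * a 0 + ENNReal.ofReal M * ∑ j ∈ Finset.range N, a j := by
    intro N
    induction N with
    | zero => simpa [abs_sub_comm] using hfirst
    | succ N ih =>
      refine (htri _ (P x (rad N) x) _).trans ((add_le_add (hstep N) ih).trans_eq ?_)
      rw [Finset.sum_range_succ]
      ring
  have hN : ∀ N, ENNReal.ofReal |f x - P z₁ ρ₁ x| ≤
      ENNReal.ofReal M * b N + ENNReal.ofReal (2 * M) * ∑' j, a j := by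
    intro N
    refine (htri _ (P x (rad N) x) _).trans (add_le_add ?_ ((hchain N).trans ?_))
    · rw [abs_sub_comm]
      exact hlast N
    · rw [ENNReal.ofReal_mul (by norm_num), ENNReal.ofReal_ofNat, two_mul, add_mul]
      gcongr
      · exact ENNReal.le_tsum 0
      · exact ENNReal.sum_le_tsum _
  have hlim : Filter.Tendsto (fun N => ENNReal.ofReal M * b N +
      ENNReal.ofReal (2 * M) * ∑' j, a j) Filter.atTop
      (nhds (ENNReal.ofReal (2 * M) * ∑' j, a j)) := by
    have h := (ENNReal.Tendsto.const_mul (hx.comp hrad_tendsto)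
      (Or.inr (ENNReal.ofReal_ne_top (r := M)))).add_const
      (ENNReal.ofReal (2 * M) * ∑' j, a j)
    simpa using h
  exact ge_of_tendsto' hlim hN
end

section
/- Let k ∈ ℕ, p ∈ [1,∞), q ∈ (0,∞), β ∈ ℝ∖{1}, and let υ be a nonnegative locally integrable function on ℝ. Then there exists a constant C > 0 such that for every locally integrable f : ℝ → ℝ, sup_{λ∈(0,∞)} λ^p ∫_ℝ [∫_0^∞ 1_{E^♠_{λ,β,k}[f]}(x,r) r^{q(β−1)−1} dr]^{p/q} υ(x) dx ≤ C sup_{λ∈(0,∞)} λ^p ∑_{α∈{0,1/3,2/3}} ∑_{Q ∈ D^α_{λ,β,k}[f]} |Q|^{p(β−1)} υ(Q). -/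
open MeasureTheory Filter Set
open scoped ENNReal NNReal BigOperators Topology Classical

noncomputable section

/-- The `k`-th order difference on `ℝ`: `Δ_h^k f (x) = ∑_{j=0}^k (-1)^{k-j} C(k,j) f (x + j h)`. -/
def kDiff1 (k : ℕ) (f : ℝ → ℝ) (h x : ℝ) : ℝ :=
  ∑ j ∈ Finset.range (k + 1), (-1 : ℝ) ^ (k - j) * (k.choose j : ℝ) * f (x + (j : ℝ) * h)

/-- Membership of `(x,h)` in `E_{λ,b,k}[f]` on `ℝ`. -/
def memE1 (k : ℕ) (lam b : ℝ) (f : ℝ → ℝ) (x h : ℝ) : Prop :=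
  h ≠ 0 ∧ lam * |h| ^ ((k : ℝ) + b) < |kDiff1 k f h x|

/-- `∫_ℝ 1_{E_{λ,b,k}[f]}(x,h) |h|^{γ-1} dh`. -/
def innerInt1 (k : ℕ) (lam b γ : ℝ) (f : ℝ → ℝ) (x : ℝ) : ℝ≥0∞ :=
  ∫⁻ h, if memE1 k lam b f x h then ENNReal.ofReal (|h| ^ (γ - 1)) else 0

/-- `g` is the `k`-th order weak derivative of `f` on `ℝ`. -/
def HasWeakDeriv1 (k : ℕ) (f g : ℝ → ℝ) : Prop :=
  LocallyIntegrable g volume ∧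
  ∀ φ : ℝ → ℝ, ContDiff ℝ (⊤ : ℕ∞) φ → HasCompactSupport φ →
    ∫ x, f x * iteratedDeriv k φ x = (-1 : ℝ) ^ k * ∫ x, g x * φ x

/-- `υ(S) = ∫_S υ` as an `ℝ≥0∞`-valued quantity. -/
def wInt1 (υ : ℝ → ℝ) (S : Set ℝ) : ℝ≥0∞ := ∫⁻ x in S, ENNReal.ofReal (υ x)

/-- The average `⨍_S υ`. -/
def avg1 (υ : ℝ → ℝ) (S : Set ℝ) : ℝ≥0∞ := wInt1 υ S / volume S

/-- The Muckenhoupt `A_p` characteristic `[υ]_{A_p}` on `ℝ`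
(suprema over bounded intervals). -/
def ApConst1 (p : ℝ) (υ : ℝ → ℝ) : ℝ≥0∞ :=
  if p = 1 then
    ⨆ (a : ℝ) (b : ℝ) (_ : a < b),
      avg1 υ (Ioo a b) *
        essSup (fun x => (ENNReal.ofReal (υ x))⁻¹) (volume.restrict (Ioo a b))
  else
    ⨆ (a : ℝ) (b : ℝ) (_ : a < b),
      avg1 υ (Ioo a b) *
        (avg1 (fun x => υ x ^ (1 - p / (p - 1))) (Ioo a b)) ^ (p - 1)

/-- `υ` is an `A_p` weight on `ℝ`. -/
def IsAp1 (p : ℝ) (υ : ℝ → ℝ) : Prop :=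
  (∀ x, 0 ≤ υ x) ∧ LocallyIntegrable υ volume ∧ ApConst1 p υ < ⊤

/-- The interval `2^j(m + [0,1) + (-1)^j α)` of the shifted dyadic grid `D^α` on `ℝ`. -/
def dyInt (αv : ℝ) (j m : ℤ) : Set ℝ :=
  Ico ((2 : ℝ) ^ j * ((m : ℝ) + (-1 : ℝ) ^ j * αv))
    ((2 : ℝ) ^ j * ((m : ℝ) + (-1 : ℝ) ^ j * αv + 1))

/-- The local approximation `E_k(f,S) = inf_{deg P ≤ k-1} ∫_S |f - P|` on `ℝ`. -/
def locApprox1 (k : ℕ) (f : ℝ → ℝ) (S : Set ℝ) : ℝ≥0∞ :=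
  ⨅ (P : Polynomial ℝ) (_ : P.natDegree ≤ k - 1),
    ∫⁻ y in S, ENNReal.ofReal |f y - P.eval y|

/-- The dyadic interval indexed by `(j,m)` of the grid `D^α` belongs to
`D^α_{λ,β,k}[f]`, i.e. `E_k(f,Q) > λ |Q|^{β+k}`. -/
def inGrid1 (αv : ℝ) (k : ℕ) (lam β : ℝ) (f : ℝ → ℝ) (j m : ℤ) : Prop :=
  ENNReal.ofReal lam * (volume (dyInt αv j m)) ^ (β + (k : ℝ))
    < locApprox1 k f (dyInt αv j m)

/-- `∑_{Q ∈ D^α_{λ,β,k}[f]} |Q|^{p(β-1)} υ(Q)` on `ℝ`. -/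
def dySum1 (αv : ℝ) (k : ℕ) (lam β p : ℝ) (f υ : ℝ → ℝ) : ℝ≥0∞ :=
  ∑' (j : ℤ) (m : ℤ),
    if inGrid1 αv k lam β f j m then
      (volume (dyInt αv j m)) ^ (p * (β - 1)) * wInt1 υ (dyInt αv j m)
    else 0

end

noncomputable section

open MeasureTheory Set
open scoped ENNReal Classical

/-- `Δ^k_{x,y} f = ∑_{j=0}^k (-1)^{k-j} C(k,j) f(((k-j)x + jy)/k)`. -/
def symDiff (k : ℕ) (f : ℝ → ℝ) (x y : ℝ) : ℝ :=
  ∑ j ∈ Finset.range (k + 1), (-1 : ℝ) ^ (k - j) * (k.choose j : ℝ) *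
    f ((((k - j : ℕ) : ℝ) * x + (j : ℝ) * y) / (k : ℝ))

/-- `∫_{x-r}^{x+r} ∫_{x-r}^{x+r} |Δ^k_{y,z} f| dy dz`. -/
def sqInt (k : ℕ) (f : ℝ → ℝ) (x r : ℝ) : ℝ≥0∞ :=
  ∫⁻ z in Ioo (x - r) (x + r), ∫⁻ y in Ioo (x - r) (x + r),
    ENNReal.ofReal |symDiff k f y z|

/-- Membership of `(x,r)` in `E^♠_{λ,β,k}[f]`. -/
def memSpade (k : ℕ) (lam β : ℝ) (f : ℝ → ℝ) (x r : ℝ) : Prop :=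
  ENNReal.ofReal (lam * r ^ ((k : ℝ) + β + 1)) < sqInt k f x r

end

open MeasureTheory Set
open scoped ENNReal Classical

/-- A sparse geometric series with ratio different from one is comparable to its extremal term, so
powers can be moved inside the sum. -/
lemma exists_rpow_tsum_two_rpow_le {γ s : ℝ} (hγ : γ ≠ 0) (hs : 0 < s) :
    ∃ C : ℝ≥0∞, C ≠ ⊤ ∧ ∀ S : Set ℤ,
      (∑' j : ℤ, if j ∈ S then (2 : ℝ≥0∞) ^ ((j : ℝ) * γ) else 0) ^ s ≤
        C * ∑' j : ℤ, if j ∈ S then (2 : ℝ≥0∞) ^ ((j : ℝ) * (γ * s)) else 0 := by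
  wlog hpos : 0 < γ generalizing γ with H
  · obtain ⟨C, hC, h⟩ := H (γ := -γ) (neg_ne_zero.2 hγ) (by
      rcases lt_or_gt_of_ne hγ with h | h
      · linarith
      · exact absurd h hpos)
    refine ⟨C, hC, fun S => ?_⟩
    have := h (-S)
    rw [← (Equiv.neg ℤ).tsum_eq, ← (Equiv.neg ℤ).tsum_eq
      (fun j : ℤ => if j ∈ -S then (2 : ℝ≥0∞) ^ ((j : ℝ) * (-γ * s)) else 0)] at this
    simpa using this
  have hρ1 : (2 : ℝ≥0∞) ^ (-γ) < 1 :=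
    ENNReal.rpow_lt_one_of_one_lt_of_neg (by norm_num) (by linarith)
  set K : ℝ≥0∞ := (1 - (2 : ℝ≥0∞) ^ (-γ))⁻¹ with hK
  have hKtop : K ≠ ⊤ := by
    rw [hK, Ne, ENNReal.inv_eq_top]
    exact (tsub_pos_of_lt hρ1).ne'
  have hK0 : K ≠ 0 := by
    rw [hK, Ne, ENNReal.inv_eq_zero]
    exact ne_top_of_le_ne_top ENNReal.one_ne_top tsub_le_self
  refine ⟨K ^ s, ENNReal.rpow_ne_top_of_nonneg hs.le hKtop, fun S => ?_⟩
  by_cases hfin : (∑' j : ℤ, if j ∈ S then (2 : ℝ≥0∞) ^ ((j : ℝ) * (γ * s)) else 0) = ⊤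
  · rw [hfin, ENNReal.mul_top]
    · exact le_top
    · simp [ENNReal.rpow_eq_zero_iff, hK0, hKtop]
  have hF := ENNReal.finite_const_le_of_tsum_ne_top hfin one_ne_zero
  rcases S.eq_empty_or_nonempty with rfl | hne
  · simp [hs]
  have hbdd : BddAbove S := by
    refine (hF.bddAbove.union (bddAbove_Iic (a := (0 : ℤ)))).mono fun j hj => ?_
    rcases le_total j 0 with h | h
    · exact Or.inr h
    · left
      simp only [Set.mem_ofPred_eq, if_pos hj]
      rw [← ENNReal.rpow_zero (x := 2)]
      have : (0 : ℝ) ≤ j := by exact_mod_cast h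
      exact ENNReal.rpow_le_rpow_of_exponent_le one_le_two (by positivity)
  obtain ⟨M, hM, hmax⟩ : ∃ M ∈ S, ∀ j ∈ S, j ≤ M :=
    ⟨sSup S, Int.csSup_mem hne hbdd, fun j hj => le_csSup hbdd hj⟩
  have hsum : (∑' j : ℤ, if j ∈ S then (2 : ℝ≥0∞) ^ ((j : ℝ) * γ) else 0) ≤
      K * (2 : ℝ≥0∞) ^ ((M : ℝ) * γ) := by
    have hinj : Function.Injective (fun n : ℕ => M - (n : ℤ)) := fun a b h => by
      simpa using h
    calc _ = ∑' n : ℕ, (if M - (n : ℤ) ∈ S then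
          (2 : ℝ≥0∞) ^ (((M - (n : ℤ) : ℤ) : ℝ) * γ) else 0) := by
          refine (hinj.tsum_eq (f := fun j : ℤ =>
            if j ∈ S then (2 : ℝ≥0∞) ^ ((j : ℝ) * γ) else 0) ?_).symm
          intro j hj
          have hjS : j ∈ S := by
            by_contra h
            simp [h] at hj
          exact ⟨(M - j).toNat, by have := hmax j hjS; simp; omega⟩
      _ ≤ ∑' n : ℕ, ((2 : ℝ≥0∞) ^ (-γ)) ^ n * (2 : ℝ≥0∞) ^ ((M : ℝ) * γ) := by
          refine ENNReal.tsum_le_tsum fun n => ?_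
          split_ifs
          · rw [← ENNReal.rpow_natCast, ← ENNReal.rpow_mul,
              ← ENNReal.rpow_add _ _ two_ne_zero ENNReal.ofNat_ne_top]
            apply le_of_eq
            congr 1
            push_cast
            ring
          · exact zero_le
      _ = _ := by rw [ENNReal.tsum_mul_right, ENNReal.tsum_geometric]
  calc _ ≤ (K * (2 : ℝ≥0∞) ^ ((M : ℝ) * γ)) ^ s := ENNReal.rpow_le_rpow hsum hs.le
    _ = K ^ s * (2 : ℝ≥0∞) ^ ((M : ℝ) * (γ * s)) := by
        rw [ENNReal.mul_rpow_of_nonneg _ _ hs.le, ← ENNReal.rpow_mul, mul_assoc]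
    _ ≤ _ := by
        gcongr
        refine le_trans ?_ (ENNReal.le_tsum M)
        rw [if_pos hM]

/-- The power integral over a dyadic shell. -/
lemma lintegral_dyadic_shell_le (γ : ℝ) (j : ℤ) :
    ∫⁻ r in Ico ((2 : ℝ) ^ j) (2 ^ (j + 1)), ENNReal.ofReal (r ^ (γ - 1)) ≤
      (2 : ℝ≥0∞) ^ |γ - 1| * (2 : ℝ≥0∞) ^ ((j : ℝ) * γ) := by
  have hj : (0 : ℝ) < 2 ^ j := by positivity
  have key : ∀ r ∈ Ico ((2 : ℝ) ^ j) (2 ^ (j + 1)), ENNReal.ofReal (r ^ (γ - 1)) ≤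
      ENNReal.ofReal (2 ^ |γ - 1| * (2 ^ j) ^ (γ - 1)) := by
    intro r hr
    apply ENNReal.ofReal_le_ofReal
    have h1 : 1 ≤ r / 2 ^ j := by rw [one_le_div hj]; exact hr.1
    have h2 : r / 2 ^ j ≤ 2 := by
      rw [div_le_iff₀ hj]
      have := hr.2.le
      rw [zpow_add_one₀ two_ne_zero] at this
      linarith
    calc r ^ (γ - 1) = (r / 2 ^ j) ^ (γ - 1) * (2 ^ j) ^ (γ - 1) := by
          rw [← Real.mul_rpow (by linarith) hj.le, div_mul_cancel₀ _ hj.ne']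
      _ ≤ _ := by
          gcongr
          calc (r / 2 ^ j) ^ (γ - 1) ≤ (r / 2 ^ j) ^ |γ - 1| :=
                Real.rpow_le_rpow_of_exponent_le h1 (le_abs_self _)
            _ ≤ _ := Real.rpow_le_rpow (by linarith) h2 (abs_nonneg _)
  calc _ ≤ ∫⁻ _ in Ico ((2 : ℝ) ^ j) (2 ^ (j + 1)),
        ENNReal.ofReal (2 ^ |γ - 1| * (2 ^ j) ^ (γ - 1)) :=
        setLIntegral_mono' measurableSet_Ico key
    _ = ENNReal.ofReal (2 ^ |γ - 1| * (2 ^ j) ^ (γ - 1) * 2 ^ j) := by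
        rw [setLIntegral_const, Real.volume_Ico, ← ENNReal.ofReal_mul (by positivity),
          zpow_add_one₀ two_ne_zero]
        congr 2
        ring
    _ = _ := by
        rw [mul_assoc, ENNReal.ofReal_mul (by positivity), Real.rpow_sub_one hj.ne',
          div_mul_cancel₀ _ hj.ne', ← Real.rpow_intCast, ← Real.rpow_mul zero_le_two,
          ← ENNReal.ofReal_rpow_of_pos two_pos, ← ENNReal.ofReal_rpow_of_pos two_pos]
        simp

lemma measurableSet_dyInt (αv : ℝ) (j m : ℤ) : MeasurableSet (dyInt αv j m) :=
  measurableSet_Ico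

lemma volume_dyInt (αv : ℝ) (j m : ℤ) : volume (dyInt αv j m) = (2 : ℝ≥0∞) ^ (j : ℝ) := by
  rw [dyInt, Real.volume_Ico, ← mul_sub, add_sub_cancel_left, mul_one, ← Real.rpow_intCast,
    ← ENNReal.ofReal_rpow_of_pos two_pos]
  simp

/-- A ball of radius comparable to `2 ^ j` lies in an interval of length `2 ^ (j + 4)` of one of the
shifted dyadic grids. -/
lemma exists_Ioo_subset_dyInt {x r : ℝ} {j : ℤ} (hr : r ∈ Ico ((2 : ℝ) ^ j) (2 ^ (j + 1))) :
    ∃ αv ∈ ({0, 1/3, 2/3} : Finset ℝ), ∃ m : ℤ, Ioo (x - r) (x + r) ⊆ dyInt αv (j + 4) m := by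
  set s : ℝ := 2 ^ (j + 4) with hs
  have hs0 : 0 < s := by positivity
  have hj : (2 : ℝ) ^ (j + 1) = s / 8 := by
    rw [hs, zpow_add_one₀ two_ne_zero, zpow_add₀ two_ne_zero]
    norm_num
    ring
  have hrs : 2 * r < s / 4 := by have := hr.2; linarith
  have key : ∀ (αv : ℝ) (m : ℤ), (m : ℝ) + (-1 : ℝ) ^ (j + 4) * αv ≤ (x - r) / s →
      (x - r) / s + 1 / 4 ≤ (m : ℝ) + (-1 : ℝ) ^ (j + 4) * αv + 1 →
      Ioo (x - r) (x + r) ⊆ dyInt αv (j + 4) m := by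
    intro αv m h1 h2 y hy
    rw [le_div_iff₀ hs0] at h1
    rw [← le_sub_iff_add_le, div_le_iff₀ hs0] at h2
    rw [dyInt, ← hs]
    constructor
    · linarith [hy.1]
    · linarith [hy.2]
  set u := (x - r) / s
  have hu := Int.floor_le u
  have hu' := Int.lt_floor_add_one u
  by_cases h : u + 1 / 4 ≤ ⌊u⌋ + 1
  · exact ⟨0, by simp, ⌊u⌋, key _ _ (by simpa using hu) (by simpa using h)⟩
  · push Not at h
    rcases Int.even_or_odd (j + 4) with he | ho
    · refine ⟨1/3, by simp, ⌊u⌋, key _ _ ?_ ?_⟩ <;> rw [he.neg_one_zpow] <;> linarith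
    · refine ⟨1/3, by simp, ⌊u⌋ + 1, key _ _ ?_ ?_⟩ <;> rw [ho.neg_one_zpow] <;> push_cast <;>
        linarith

lemma symDiff_sub (k : ℕ) (f g : ℝ → ℝ) (x y : ℝ) :
    symDiff k (fun t => f t - g t) x y = symDiff k f x y - symDiff k g x y := by
  simp only [symDiff, mul_sub, Finset.sum_sub_distrib]

/-- Differences of order `k` annihilate polynomials of degree less than `k`. -/
lemma symDiff_polynomial {k : ℕ} {P : Polynomial ℝ} (hP : P.natDegree < k) (x y : ℝ) :
    symDiff k (fun t => P.eval t) x y = 0 := by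
  have hk : (k : ℝ) ≠ 0 := by
    have : k ≠ 0 := by omega
    exact_mod_cast this
  set Q : Polynomial ℝ := P.comp (Polynomial.C ((y - x) / k) * Polynomial.X + Polynomial.C x)
  have hQ : Q.natDegree < k := by
    refine lt_of_le_of_lt ?_ hP
    refine Polynomial.natDegree_comp_le.trans ?_
    calc _ ≤ P.natDegree * 1 := Nat.mul_le_mul_left _ Polynomial.natDegree_linear_le
      _ = _ := mul_one _
  have h := congrFun (Polynomial.fwdDiff_iter_eq_zero_of_degree_lt hQ) 0
  rw [fwdDiff_iter_eq_sum_shift] at h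
  rw [symDiff, ← Pi.zero_apply (M := fun _ : ℝ => ℝ) 0, ← h]
  refine Finset.sum_congr rfl fun j hj => ?_
  have hjk : j ≤ k := by simpa [Nat.lt_succ_iff] using hj
  have : (((k - j : ℕ) : ℝ) * x + (j : ℝ) * y) / (k : ℝ) = (y - x) / k * j + x := by
    rw [Nat.cast_sub hjk]
    field_simp
    ring
  simp [Q, this]

lemma lintegral_comp_mul_add {a : ℝ} (ha : 0 < a) (b : ℝ) (G : ℝ → ℝ≥0∞) :
    ∫⁻ y, G (a * y + b) = ENNReal.ofReal a⁻¹ * ∫⁻ y, G y := by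
  have h1 : ∫⁻ y, G (a * y + b) = ∫⁻ y, G (y + b) ∂(Measure.map (a * ·) volume) :=
    (MeasureTheory.lintegral_map_equiv (fun y => G (y + b))
      (Homeomorph.mulLeft₀ a ha.ne').toMeasurableEquiv).symm
  rw [h1, Real.map_volume_mul_left ha.ne', lintegral_smul_measure, lintegral_add_right_eq_self,
    abs_of_pos (inv_pos.2 ha), smul_eq_mul]

lemma quasiMeasurePreserving_mul_add {a : ℝ} (ha : a ≠ 0) (b : ℝ) :
    Measure.QuasiMeasurePreserving (fun y : ℝ => a * y + b) volume volume := by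
  have hmul : Measure.QuasiMeasurePreserving (fun y : ℝ => a * y) volume volume :=
    ⟨by fun_prop, by
      rw [Real.map_volume_mul_left ha]
      exact Measure.smul_absolutelyContinuous⟩
  exact (measurePreserving_add_right volume b).quasiMeasurePreserving.comp hmul

/-- The averaged difference on a ball is controlled by the distance to any polynomial of degree less
than `k`. -/
lemma sqInt_le {k : ℕ} {f : ℝ → ℝ} (hf : LocallyIntegrable f volume) {P : Polynomial ℝ}
    (hP : P.natDegree < k) (x r : ℝ) :
    sqInt k f x r ≤ ENNReal.ofReal (2 * r) * ((2 ^ k * k + 1) *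
      ∫⁻ y in Ioo (x - r) (x + r), ENNReal.ofReal |f y - P.eval y|) := by
  have hk : 0 < k := by omega
  have hk0 : (0 : ℝ) < k := by exact_mod_cast hk
  set B := Ioo (x - r) (x + r) with hB
  set g : ℝ → ℝ≥0∞ := fun y => ENNReal.ofReal |f y - P.eval y| with hg
  have hgm : AEMeasurable g volume :=
    ((hf.aestronglyMeasurable.aemeasurable.sub P.continuous.aemeasurable).abs).ennreal_ofReal
  set I := ∫⁻ y in B, g y with hI
  have hvol : volume B = ENNReal.ofReal (2 * r) := by
    rw [hB, Real.volume_Ioo]; congr 1; ring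
  have hpt : ∀ y z, ENNReal.ofReal |symDiff k f y z| ≤
      (∑ j ∈ Finset.range k, (k.choose j : ℝ≥0∞) *
        g ((((k - j : ℕ) : ℝ) * y + (j : ℝ) * z) / (k : ℝ))) + g z := by
    intro y z
    have h1 : symDiff k f y z = symDiff k (fun t => f t - P.eval t) y z := by
      rw [symDiff_sub, symDiff_polynomial hP, sub_zero]
    rw [h1]
    calc _ ≤ ENNReal.ofReal (∑ j ∈ Finset.range (k + 1), (k.choose j : ℝ) *
          |f ((((k - j : ℕ) : ℝ) * y + (j : ℝ) * z) / (k : ℝ)) -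
            P.eval ((((k - j : ℕ) : ℝ) * y + (j : ℝ) * z) / (k : ℝ))|) := by
          apply ENNReal.ofReal_le_ofReal
          rw [symDiff]
          refine (Finset.abs_sum_le_sum_abs _ _).trans (le_of_eq ?_)
          refine Finset.sum_congr rfl fun j _ => ?_
          rw [abs_mul, abs_mul, abs_pow, abs_neg, abs_one, one_pow, one_mul, Nat.abs_cast]
      _ = _ := by
          rw [ENNReal.ofReal_sum_of_nonneg (fun _ _ => by positivity), Finset.sum_range_succ]
          congr 1
          · refine Finset.sum_congr rfl fun j _ => ?_
            rw [ENNReal.ofReal_mul (by positivity), ENNReal.ofReal_natCast]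
          · simp [hg, mul_div_cancel_left₀ _ hk0.ne']
  have hterm : ∀ z ∈ B, ∀ j ∈ Finset.range k,
      ∫⁻ y in B, g ((((k - j : ℕ) : ℝ) * y + (j : ℝ) * z) / (k : ℝ)) ≤ k * I := by
    intro z hz j hj
    have hjk : j < k := Finset.mem_range.1 hj
    have hkj : (1 : ℝ) ≤ ((k - j : ℕ) : ℝ) := by exact_mod_cast (by omega : 1 ≤ k - j)
    have ha : (0 : ℝ) < ((k - j : ℕ) : ℝ) / k := by positivity
    have hform : ∀ y : ℝ, (((k - j : ℕ) : ℝ) * y + (j : ℝ) * z) / (k : ℝ) =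
        ((k - j : ℕ) : ℝ) / k * y + (j : ℝ) / k * z := fun y => by ring
    have hsum : ((k - j : ℕ) : ℝ) / k + (j : ℝ) / k = 1 := by
      rw [← add_div, Nat.cast_sub hjk.le, sub_add_cancel, div_self hk0.ne']
    calc _ ≤ ∫⁻ y in B, B.indicator g (((k - j : ℕ) : ℝ) / k * y + (j : ℝ) / k * z) := by
          refine setLIntegral_mono' measurableSet_Ioo fun y hy => ?_
          rw [hform, indicator_of_mem]
          exact (convex_Ioo _ _) hy hz ha.le (by positivity) hsum
      _ ≤ ∫⁻ y, B.indicator g (((k - j : ℕ) : ℝ) / k * y + (j : ℝ) / k * z) :=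
          setLIntegral_le_lintegral _ _
      _ = ENNReal.ofReal (((k - j : ℕ) : ℝ) / k)⁻¹ * I := by
          rw [lintegral_comp_mul_add ha, lintegral_indicator measurableSet_Ioo]
      _ ≤ _ := by
          gcongr
          rw [← ENNReal.ofReal_natCast]
          apply ENNReal.ofReal_le_ofReal
          rw [inv_div]
          exact div_le_self hk0.le hkj
  have hinner : ∀ z ∈ B, ∫⁻ y in B, ENNReal.ofReal |symDiff k f y z| ≤
      2 ^ k * (k * I) + ENNReal.ofReal (2 * r) * g z := by
    intro z hz
    calc _ ≤ ∫⁻ y in B, ((∑ j ∈ Finset.range k, (k.choose j : ℝ≥0∞) *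
        g ((((k - j : ℕ) : ℝ) * y + (j : ℝ) * z) / (k : ℝ))) + g z) :=
          lintegral_mono fun y => hpt y z
      _ = (∑ j ∈ Finset.range k, (k.choose j : ℝ≥0∞) *
          ∫⁻ y in B, g ((((k - j : ℕ) : ℝ) * y + (j : ℝ) * z) / (k : ℝ))) +
            ENNReal.ofReal (2 * r) * g z := by
          rw [lintegral_add_right _ measurable_const, setLIntegral_const, hvol, mul_comm (g z),
            lintegral_finsetSum']
          · congr 1
            refine Finset.sum_congr rfl fun j _ => ?_
            rw [lintegral_const_mul' _ _ (ENNReal.natCast_ne_top _)]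
          · intro j hj
            refine AEMeasurable.const_mul ?_ _
            have hjk : j < k := Finset.mem_range.1 hj
            have hkj : (((k - j : ℕ) : ℝ) / k) ≠ 0 := by
              have : (0:ℝ) < ((k - j : ℕ) : ℝ) := by exact_mod_cast (by omega : 0 < k - j)
              positivity
            have hform : ∀ y : ℝ, (((k - j : ℕ) : ℝ) * y + (j : ℝ) * z) / (k : ℝ) =
                ((k - j : ℕ) : ℝ) / k * y + (j : ℝ) / k * z := fun y => by ring
            simp_rw [hform]
            exact (hgm.comp_quasiMeasurePreserving
              (quasiMeasurePreserving_mul_add hkj _)).restrict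
      _ ≤ (∑ j ∈ Finset.range (k + 1), (k.choose j : ℝ≥0∞) * (k * I)) +
            ENNReal.ofReal (2 * r) * g z := by
          gcongr
          refine (Finset.sum_le_sum fun j hj => ?_).trans
            (Finset.sum_le_sum_of_subset (Finset.range_subset_range.2 (Nat.le_succ k)))
          gcongr
          exact hterm z hz j hj
      _ = _ := by
          rw [← Finset.sum_mul, ← Nat.cast_sum, Nat.sum_range_choose]
          norm_num
  calc sqInt k f x r ≤ ∫⁻ z in B, (2 ^ k * (k * I) + ENNReal.ofReal (2 * r) * g z) :=
        setLIntegral_mono' measurableSet_Ioo hinner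
    _ = _ := by
        rw [lintegral_add_left measurable_const, setLIntegral_const, hvol,
          lintegral_const_mul' _ _ ENNReal.ofReal_ne_top]
        ring

lemma sqInt_le_locApprox1 {k : ℕ} (hk : 0 < k) {f : ℝ → ℝ} (hf : LocallyIntegrable f volume)
    {x r : ℝ} (hr : 0 < r) {Q : Set ℝ} (hQ : Ioo (x - r) (x + r) ⊆ Q) :
    sqInt k f x r ≤ ENNReal.ofReal (2 * (2 ^ k * k + 1) * r) * locApprox1 k f Q := by
  have hc0 : ENNReal.ofReal (2 * (2 ^ k * k + 1) * r) ≠ 0 := by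
    rw [Ne, ENNReal.ofReal_eq_zero, not_le]
    positivity
  rw [mul_comm, ← ENNReal.div_le_iff hc0 ENNReal.ofReal_ne_top, locApprox1]
  refine le_iInf₂ fun P hP => ?_
  rw [ENNReal.div_le_iff hc0 ENNReal.ofReal_ne_top]
  have hconst : ENNReal.ofReal (2 * (2 ^ k * k + 1) * r) =
      ENNReal.ofReal (2 * r) * (2 ^ k * k + 1) := by
    rw [show 2 * ((2 : ℝ) ^ k * k + 1) * r = 2 * r * (2 ^ k * k + 1) by ring,
      ENNReal.ofReal_mul (by positivity)]
    congr 1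
    exact_mod_cast ENNReal.ofReal_natCast (2 ^ k * k + 1)
  calc sqInt k f x r ≤ _ := sqInt_le hf (lt_of_le_of_lt hP (by omega)) x r
    _ ≤ ENNReal.ofReal (2 * r) * ((2 ^ k * k + 1) *
        ∫⁻ y in Q, ENNReal.ofReal |f y - P.eval y|) := by
        gcongr
    _ = _ := by rw [hconst]; ring

/-- If `(x, r)` lies in the `♠` level set, then every dyadic interval of length comparable to `r`
containing the ball lies in the corresponding dyadic level set. -/
lemma inGrid1_of_memSpade {k : ℕ} (hk : 0 < k) {f : ℝ → ℝ} (hf : LocallyIntegrable f volume)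
    {lam β x r αv : ℝ} {j m : ℤ} (hlam : 0 < lam) (hr : r ∈ Ico ((2 : ℝ) ^ j) (2 ^ (j + 1)))
    (hQ : Ioo (x - r) (x + r) ⊆ dyInt αv (j + 4) m) (h : memSpade k lam β f x r) :
    inGrid1 αv k ((2 * (2 ^ k * k + 1) * (16 : ℝ) ^ |β + k|)⁻¹ * lam) β f (j + 4) m := by
  have hj : (0 : ℝ) < 2 ^ j := by positivity
  have hr0 : 0 < r := lt_of_lt_of_le hj hr.1
  set A : ℝ := 2 * (2 ^ k * k + 1) with hA
  have hA0 : 0 < A := by positivity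
  have hL : (2 : ℝ) ^ (j + 4) = 16 * 2 ^ j := by
    rw [zpow_add₀ two_ne_zero]
    norm_num
    ring
  have hpow : ((2 : ℝ) ^ (j + 4)) ^ (β + k) ≤ 16 ^ |β + k| * r ^ (β + k) := by
    have h1 : 1 ≤ (2 : ℝ) ^ (j + 4) / r := by
      rw [one_le_div hr0, hL]
      have := hr.2
      rw [zpow_add_one₀ two_ne_zero] at this
      linarith
    have h2 : (2 : ℝ) ^ (j + 4) / r ≤ 16 := by
      rw [div_le_iff₀ hr0, hL]
      linarith [hr.1]
    calc ((2 : ℝ) ^ (j + 4)) ^ (β + k) = ((2 : ℝ) ^ (j + 4) / r) ^ (β + k) * r ^ (β + k) := by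
          rw [← Real.mul_rpow (by positivity) hr0.le, div_mul_cancel₀ _ hr0.ne']
      _ ≤ _ := by
          gcongr
          calc _ ≤ ((2 : ℝ) ^ (j + 4) / r) ^ |β + k| :=
                Real.rpow_le_rpow_of_exponent_le h1 (le_abs_self _)
            _ ≤ _ := Real.rpow_le_rpow (by positivity) h2 (abs_nonneg _)
  have hvol : volume (dyInt αv (j + 4) m) ^ (β + (k : ℝ)) =
      ENNReal.ofReal (((2 : ℝ) ^ (j + 4)) ^ (β + k)) := by
    rw [volume_dyInt, ← Real.rpow_intCast, ← ENNReal.ofReal_rpow_of_pos (by positivity),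
      ← ENNReal.ofReal_rpow_of_pos two_pos]
    simp
  have hc0 : ENNReal.ofReal (A * r) ≠ 0 := by
    rw [Ne, ENNReal.ofReal_eq_zero, not_le]
    positivity
  rw [inGrid1, hvol, ← ENNReal.ofReal_mul (by positivity),
    ← ENNReal.mul_lt_mul_iff_right hc0 ENNReal.ofReal_ne_top]
  refine lt_of_le_of_lt ?_ (lt_of_lt_of_le h (sqInt_le_locApprox1 hk hf hr0 hQ))
  rw [← ENNReal.ofReal_mul (by positivity)]
  apply ENNReal.ofReal_le_ofReal
  have h16 : (0 : ℝ) < 16 ^ |β + k| := by positivity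
  calc A * r * ((A * 16 ^ |β + k|)⁻¹ * lam * ((2 : ℝ) ^ (j + 4)) ^ (β + k))
      ≤ A * r * ((A * 16 ^ |β + k|)⁻¹ * lam * (16 ^ |β + k| * r ^ (β + k))) := by gcongr
    _ = lam * (r ^ (β + k) * r) := by field_simp
    _ = lam * r ^ ((k : ℝ) + β + 1) := by
        rw [← Real.rpow_add_one hr0.ne', add_comm β]

lemma Ioi_zero_subset_iUnion_dyadic : Ioi (0 : ℝ) ⊆ ⋃ j : ℤ, Ico ((2 : ℝ) ^ j) (2 ^ (j + 1)) :=
  fun _ hr => mem_iUnion.2 (exists_mem_Ico_zpow hr one_lt_two)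

lemma lintegral_Ioi_le_tsum_dyadic (γ : ℝ) (T : Set ℝ) :
    (∫⁻ r in Ioi (0 : ℝ), if r ∈ T then ENNReal.ofReal (r ^ (γ - 1)) else 0) ≤
      (2 : ℝ≥0∞) ^ |γ - 1| * ∑' j : ℤ,
        if j ∈ {j : ℤ | ∃ r ∈ Ico ((2 : ℝ) ^ j) (2 ^ (j + 1)), r ∈ T} then
          (2 : ℝ≥0∞) ^ ((j : ℝ) * γ) else 0 := by
  rw [← ENNReal.tsum_mul_left]
  refine (lintegral_mono_set Ioi_zero_subset_iUnion_dyadic).trans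
    ((lintegral_iUnion_le _ _).trans (ENNReal.tsum_le_tsum fun j => ?_))
  split_ifs with h
  · refine le_trans (lintegral_mono fun r => ?_) (lintegral_dyadic_shell_le γ j)
    split_ifs
    · exact le_rfl
    · exact zero_le
  · rw [mul_zero, nonpos_iff_eq_zero]
    refine setLIntegral_eq_zero measurableSet_Ico fun r hr => ?_
    exact if_neg fun hT => h ⟨r, hr, hT⟩

lemma lintegral_sum_indicator_mul_eq {υ : ℝ → ℝ} (hυ : AEMeasurable υ volume) (αs : Finset ℝ)
    (w : ℝ → ℤ → ℤ → ℝ≥0∞) (hw : ∀ a j m, w a j m ≠ ⊤) :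
    ∫⁻ x, (∑' j : ℤ, ∑ αv ∈ αs, ∑' m : ℤ,
        (dyInt αv j m).indicator (fun _ => w αv j m) x) * ENNReal.ofReal (υ x) =
      ∑ αv ∈ αs, ∑' (j : ℤ) (m : ℤ), w αv j m * wInt1 υ (dyInt αv j m) := by
  have hυ' : AEMeasurable (fun x => ENNReal.ofReal (υ x)) volume := hυ.ennreal_ofReal
  have hm : ∀ αv j m, AEMeasurable (fun x =>
      (dyInt αv j m).indicator (fun _ => w αv j m) x * ENNReal.ofReal (υ x)) volume :=
    fun αv j m => ((measurable_const.indicator (measurableSet_dyInt αv j m)).aemeasurable).mul hυ'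
  have hm' : ∀ αv j, AEMeasurable (fun x => ∑' m : ℤ,
      (dyInt αv j m).indicator (fun _ => w αv j m) x * ENNReal.ofReal (υ x)) volume :=
    fun αv j => AEMeasurable.tsum (hm αv j)
  simp_rw [← ENNReal.tsum_mul_right, Finset.sum_mul, ← ENNReal.tsum_mul_right]
  rw [lintegral_tsum (fun j => Finset.aemeasurable_fun_sum _ fun αv _ => hm' αv j)]
  simp_rw [lintegral_finsetSum' _ (fun αv _ => hm' αv _), lintegral_tsum (hm _ _)]
  rw [Summable.tsum_finsetSum fun _ _ => ENNReal.summable]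
  refine Finset.sum_congr rfl fun αv _ => tsum_congr fun j => tsum_congr fun m => ?_
  rw [wInt1, ← lintegral_const_mul' _ _ (hw _ _ _),
    ← lintegral_indicator (measurableSet_dyInt _ _ _)]
  refine lintegral_congr fun x => ?_
  by_cases hx : x ∈ dyInt αv j m <;> simp [hx]

/-- auxiliary estimate controlling the `E^♠` level sets by the dyadic
local-approximation level sets, on `ℝ`. -/
theorem statement12 (k : ℕ) (hk : 0 < k) (p q β : ℝ) (hp : 1 ≤ p) (hq : 0 < q)
    (hβ : β ≠ 1) (υ : ℝ → ℝ) (hυ0 : ∀ x, 0 ≤ υ x)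
    (hυloc : LocallyIntegrable υ volume) :
    ∃ C : ℝ, 0 < C ∧
      ∀ f : ℝ → ℝ, LocallyIntegrable f volume →
        (⨆ lam ∈ Ioi (0 : ℝ), ENNReal.ofReal lam ^ p *
            ∫⁻ x, (∫⁻ r in Ioi (0 : ℝ),
                if memSpade k lam β f x r then ENNReal.ofReal (r ^ (q * (β - 1) - 1)) else 0)
              ^ (p / q) * ENNReal.ofReal (υ x))
          ≤ ENNReal.ofReal C *
              ⨆ lam ∈ Ioi (0 : ℝ), ENNReal.ofReal lam ^ p *
                ∑ αv ∈ ({0, 1/3, 2/3} : Finset ℝ), dySum1 αv k lam β p f υ := by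
  set γ : ℝ := q * (β - 1) with hγdef
  have hγ : γ ≠ 0 := mul_ne_zero hq.ne' (sub_ne_zero.2 hβ)
  have hs : 0 < p / q := by positivity
  have hγs : γ * (p / q) = p * (β - 1) := by rw [hγdef]; field_simp
  set t : ℝ := p * (β - 1) with ht
  obtain ⟨K, hK, hgeom⟩ := exists_rpow_tsum_two_rpow_le hγ hs
  rw [hγs] at hgeom
  set c : ℝ := (2 * (2 ^ k * k + 1) * (16 : ℝ) ^ |β + k|)⁻¹ with hc
  have hc0 : 0 < c := by positivity
  have h2top : ∀ u : ℝ, (2 : ℝ≥0∞) ^ u ≠ ⊤ := fun u =>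
    ENNReal.rpow_ne_top_of_ne_zero two_ne_zero ENNReal.ofNat_ne_top
  set D : ℝ≥0∞ := ((2 : ℝ≥0∞) ^ |γ - 1|) ^ (p / q) * K * 2 ^ (-4 * t) with hD
  have hDtop : D ≠ ⊤ := ENNReal.mul_ne_top (ENNReal.mul_ne_top
    (ENNReal.rpow_ne_top_of_nonneg hs.le (h2top _)) hK) (h2top _)
  set M : ℝ≥0∞ := ENNReal.ofReal c⁻¹ ^ p * D with hM
  have hMtop : M ≠ ⊤ := ENNReal.mul_ne_top
    (ENNReal.rpow_ne_top_of_nonneg (by linarith) ENNReal.ofReal_ne_top) hDtop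
  refine ⟨M.toReal + 1, by positivity, fun f hf => iSup₂_le fun lam hlam => ?_⟩
  have hlam : 0 < lam := hlam
  set w : ℝ → ℤ → ℤ → ℝ≥0∞ := fun αv j m =>
    if inGrid1 αv k (c * lam) β f j m then volume (dyInt αv j m) ^ t else 0 with hw
  have hwtop : ∀ αv j m, w αv j m ≠ ⊤ := by
    intro αv j m
    simp only [hw]
    split_ifs
    · rw [volume_dyInt, ← ENNReal.rpow_mul]
      exact h2top _
    · exact ENNReal.zero_ne_top
  have hpoint : ∀ x, (∫⁻ r in Ioi (0 : ℝ),
      if memSpade k lam β f x r then ENNReal.ofReal (r ^ (γ - 1)) else 0) ^ (p / q) ≤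
      D * ∑' j : ℤ, ∑ αv ∈ ({0, 1/3, 2/3} : Finset ℝ), ∑' m : ℤ,
        (dyInt αv j m).indicator (fun _ => w αv j m) x := by
    intro x
    have h1 := lintegral_Ioi_le_tsum_dyadic γ {r | memSpade k lam β f x r}
    set S : Set ℤ := {j : ℤ | ∃ r ∈ Ico ((2 : ℝ) ^ j) (2 ^ (j + 1)),
      r ∈ {r | memSpade k lam β f x r}} with hS
    have hterm : ∀ j : ℤ, (if j ∈ S then (2 : ℝ≥0∞) ^ ((j : ℝ) * t) else 0) ≤
        2 ^ (-4 * t) * ∑ αv ∈ ({0, 1/3, 2/3} : Finset ℝ), ∑' m : ℤ,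
          (dyInt αv (j + 4) m).indicator (fun _ => w αv (j + 4) m) x := by
      intro j
      split_ifs with hj
      · obtain ⟨r, hr, hmem⟩ := hj
        obtain ⟨αv, hα, m, hsub⟩ := exists_Ioo_subset_dyInt (x := x) hr
        have hr0 : 0 < r := lt_of_lt_of_le (by positivity) hr.1
        have hx : x ∈ dyInt αv (j + 4) m := hsub ⟨by linarith, by linarith⟩
        have hin := inGrid1_of_memSpade hk hf hlam hr hsub hmem
        calc (2 : ℝ≥0∞) ^ ((j : ℝ) * t) = 2 ^ (-4 * t) *
              (dyInt αv (j + 4) m).indicator (fun _ => w αv (j + 4) m) x := by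
              rw [indicator_of_mem hx]
              simp only [hw]
              rw [if_pos hin, volume_dyInt, ← ENNReal.rpow_mul,
                ← ENNReal.rpow_add _ _ two_ne_zero ENNReal.ofNat_ne_top]
              congr 1
              push_cast
              ring
          _ ≤ _ := by
              gcongr
              refine le_trans (ENNReal.le_tsum (f := fun m =>
                (dyInt αv (j + 4) m).indicator (fun _ => w αv (j + 4) m) x) m) ?_
              exact Finset.single_le_sum (f := fun αv => ∑' m : ℤ,
                (dyInt αv (j + 4) m).indicator (fun _ => w αv (j + 4) m) x)
                (fun _ _ => zero_le) hα
      · exact zero_le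
    calc _ ≤ ((2 : ℝ≥0∞) ^ |γ - 1| * ∑' j : ℤ,
          if j ∈ S then (2 : ℝ≥0∞) ^ ((j : ℝ) * γ) else 0) ^ (p / q) :=
          ENNReal.rpow_le_rpow h1 hs.le
      _ ≤ ((2 : ℝ≥0∞) ^ |γ - 1|) ^ (p / q) * (K * ∑' j : ℤ,
          if j ∈ S then (2 : ℝ≥0∞) ^ ((j : ℝ) * t) else 0) := by
          rw [ENNReal.mul_rpow_of_nonneg _ _ hs.le]
          gcongr
          exact hgeom S
      _ ≤ ((2 : ℝ≥0∞) ^ |γ - 1|) ^ (p / q) * (K * ∑' j : ℤ,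
          2 ^ (-4 * t) * ∑ αv ∈ ({0, 1/3, 2/3} : Finset ℝ), ∑' m : ℤ,
          (dyInt αv (j + 4) m).indicator (fun _ => w αv (j + 4) m) x) := by
          gcongr with j
          exact hterm j
      _ = _ := by
          have hshift := (Equiv.addRight (4 : ℤ)).tsum_eq (fun j : ℤ =>
            ∑ αv ∈ ({0, 1/3, 2/3} : Finset ℝ), ∑' m : ℤ,
              (dyInt αv j m).indicator (fun _ => w αv j m) x)
          simp only [Equiv.coe_addRight] at hshift
          rw [ENNReal.tsum_mul_left, hshift, hD]
          ring
  have hint : (∫⁻ x, (∫⁻ r in Ioi (0 : ℝ),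
      if memSpade k lam β f x r then ENNReal.ofReal (r ^ (γ - 1)) else 0) ^ (p / q) *
        ENNReal.ofReal (υ x)) ≤
      D * ∑ αv ∈ ({0, 1/3, 2/3} : Finset ℝ), dySum1 αv k (c * lam) β p f υ := by
    calc _ ≤ ∫⁻ x, D * ((∑' j : ℤ, ∑ αv ∈ ({0, 1/3, 2/3} : Finset ℝ), ∑' m : ℤ,
          (dyInt αv j m).indicator (fun _ => w αv j m) x) * ENNReal.ofReal (υ x)) := by
          refine lintegral_mono fun x => ?_
          rw [← mul_assoc]
          gcongr
          exact hpoint x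
      _ = D * ∑ αv ∈ ({0, 1/3, 2/3} : Finset ℝ), ∑' (j : ℤ) (m : ℤ),
          w αv j m * wInt1 υ (dyInt αv j m) := by
          rw [lintegral_const_mul' _ _ hDtop, lintegral_sum_indicator_mul_eq
            hυloc.aestronglyMeasurable.aemeasurable _ w hwtop]
      _ = _ := by
          simp only [hw, dySum1, ite_mul, zero_mul, ht]
  calc _ ≤ ENNReal.ofReal lam ^ p *
        (D * ∑ αv ∈ ({0, 1/3, 2/3} : Finset ℝ), dySum1 αv k (c * lam) β p f υ) := by gcongr
    _ = M * (ENNReal.ofReal (c * lam) ^ p *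
        ∑ αv ∈ ({0, 1/3, 2/3} : Finset ℝ), dySum1 αv k (c * lam) β p f υ) := by
        have : ENNReal.ofReal lam ^ p =
            ENNReal.ofReal c⁻¹ ^ p * ENNReal.ofReal (c * lam) ^ p := by
          rw [← ENNReal.mul_rpow_of_nonneg _ _ (by linarith : 0 ≤ p),
            ← ENNReal.ofReal_mul (by positivity), inv_mul_cancel_left₀ hc0.ne']
        rw [this, hM]
        ring
    _ ≤ _ := by
        gcongr
        · refine (ENNReal.ofReal_toReal hMtop).symm.le.trans ?_
          exact ENNReal.ofReal_le_ofReal (by linarith)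
        · exact le_iSup₂ (f := fun (l : ℝ) (_ : l ∈ Ioi (0 : ℝ)) => ENNReal.ofReal l ^ p *
            ∑ αv ∈ ({0, 1/3, 2/3} : Finset ℝ), dySum1 αv k l β p f υ) (c * lam)
            (mul_pos hc0 hlam)
end
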